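/- The Zhu algebra A(𝓗^+) is generated as an associative algebra by the finitely many elements [ω_a], [J_a] for a = 1,…,ℓ, and [h_a(−1)h_b(−1)𝟏] for distinct a,b ∈ {1,…,ℓ}. -/

import Mathlib

/-!
Common framework: vertex operator algebras over ℂ encoded via their modes,
weak/admissible/ordinary modules, twisted modules, Zhu's algebra data,
and the free bosonic (Heisenberg) vertex operator algebra `𝓗 = M(1)` of rank `ℓ`
together with its `θ`-fixed subalgebra `𝓗⁺`.
-/

open scoped BigOperators DirectSum TensorProduct

noncomputable section

/-- Generalized binomial coefficient `(q choose n)` for `q : ℚ`. -/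
def qchoose (q : ℚ) : ℕ → ℚ
  | 0 => 1
  | n + 1 => qchoose q n * (q - n) / (n + 1)

/-- Generalized binomial coefficient of an integer, as a complex number. -/
def zchoose (m : ℤ) (n : ℕ) : ℂ := ((qchoose (m : ℚ) n : ℚ) : ℂ)

/-- A vertex operator algebra over `ℂ`, encoded through its modes:
`Y u n : Module.End ℂ V` is the `n`-th mode `u_n` of the vertex operator `Y(u,z)`.
The axioms are: truncation, the vacuum and creation axioms, the (component form of
the) Jacobi/Borcherds identity, a lower-truncated `ℤ`-grading by `L(0)`-eigenvalues
with finite dimensional homogeneous pieces compatible with the modes, the Virasoro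
relations for the conformal vector and the `L(-1)`-derivative (translation) axiom. -/
structure VOA (V : Type) [AddCommGroup V] [Module ℂ V] : Type where
  Y : V →ₗ[ℂ] ℤ → Module.End ℂ V
  one : V
  omega : V
  wt : ℤ → Submodule ℂ V
  centralCharge : ℂ
  internal : DirectSum.IsInternal wt
  one_wt : one ∈ wt 0
  omega_wt : omega ∈ wt 2
  one_ne_zero : one ≠ 0
  fdim : ∀ n : ℤ, FiniteDimensional ℂ (wt n)
  bounded_below : ∃ N : ℤ, ∀ n : ℤ, n < N → wt n = ⊥
  trunc : ∀ u v : V, ∃ N : ℤ, ∀ n : ℤ, N ≤ n → Y u n v = 0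
  vacuum_act : ∀ n : ℤ, Y one n = if n = -1 then (1 : Module.End ℂ V) else 0
  create : ∀ u : V, Y u (-1) one = u
  create_ge : ∀ (u : V) (n : ℤ), 0 ≤ n → Y u n one = 0
  mode_wt : ∀ (k : ℤ) (u : V), u ∈ wt k → ∀ (m n : ℤ) (v : V), v ∈ wt m →
    Y u n v ∈ wt (m + k - n - 1)
  L0_diag : ∀ (n : ℤ) (v : V), v ∈ wt n → Y omega 1 v = (n : ℂ) • v
  translation : ∀ (u : V) (n : ℤ), Y (Y omega 0 u) n = (-(n : ℂ)) • Y u (n - 1)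
  virasoro : ∀ m n : ℤ,
    Y omega (m + 1) * Y omega (n + 1) - Y omega (n + 1) * Y omega (m + 1)
      = ((m : ℂ) - (n : ℂ)) • Y omega (m + n + 1)
        + (if m + n = 0 then (((m ^ 3 - m : ℤ) : ℂ) / 12) * centralCharge else 0)
            • (1 : Module.End ℂ V)
  borcherds : ∀ (u v w : V) (p m n : ℤ),
    ∑ᶠ i : ℕ, zchoose m i • Y (Y u (p + i) v) (m + n - i) w
      = ∑ᶠ i : ℕ, ((-1 : ℂ) ^ i * zchoose p i) •
          (Y u (m + p - i) (Y v (n + i) w)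
            - ((-1 : ℂ) ^ p) • Y v (n + p - i) (Y u (m + i) w))

variable {V : Type} [AddCommGroup V] [Module ℂ V]

/-- Simplicity of a vertex operator algebra: the only subspaces invariant under
all modes are `0` and the whole space. -/
def VOA.Simple (A : VOA V) : Prop :=
  ∀ U : Submodule ℂ V, (∀ (u : V) (n : ℤ) (v : V), v ∈ U → A.Y u n v ∈ U) → U = ⊥ ∨ U = ⊤

/-- The decomposition of a vertex operator algebra into its homogeneous pieces. -/
noncomputable def VOA.decompose (A : VOA V) : V ≃ₗ[ℂ] ⨁ n : ℤ, A.wt n :=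
  (LinearEquiv.ofBijective (DirectSum.coeLinearMap A.wt) A.internal).symm

/-- The homogeneous component of weight `n` of a vector. -/
noncomputable def VOA.hcomp (A : VOA V) (n : ℤ) (u : V) : V := (A.decompose u n : V)

/-- Zhu's product `u * v` for `u` (treated as) homogeneous of weight `k`:
`u*v = ∑_{i≥0} (k choose i) u_{i-1} v`. -/
noncomputable def VOA.mulAux (A : VOA V) (k : ℤ) (u v : V) : V :=
  ∑ᶠ i : ℕ, zchoose k i • A.Y u ((i : ℤ) - 1) v

/-- Zhu's circle product `u ∘ v` for `u` (treated as) homogeneous of weight `k`: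
`u∘v = ∑_{i≥0} (k choose i) u_{i-2} v`. -/
noncomputable def VOA.circAux (A : VOA V) (k : ℤ) (u v : V) : V :=
  ∑ᶠ i : ℕ, zchoose k i • A.Y u ((i : ℤ) - 2) v

/-- Zhu's product `u * v`, extended bilinearly via homogeneous components of `u`. -/
noncomputable def VOA.star (A : VOA V) (u v : V) : V :=
  ∑ᶠ k : ℤ, A.mulAux k (A.hcomp k u) v

/-- The subspace `O(V)` spanned by all circle products `u ∘ v` with `u` homogeneous;
Zhu's algebra is `A(V) = V/O(V)` with product induced by `VOA.star`. -/
def VOA.Osub (A : VOA V) : Submodule ℂ V :=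
  Submodule.span ℂ {w | ∃ (k : ℤ) (u v : V), u ∈ A.wt k ∧ w = A.circAux k u v}

/-- A weak module for a vertex operator algebra, given by modes satisfying
truncation, the vacuum axiom and the Borcherds identity. -/
structure WkMod (A : VOA V) (M : Type) [AddCommGroup M] [Module ℂ M] : Type where
  act : V →ₗ[ℂ] ℤ → Module.End ℂ M
  trunc : ∀ (u : V) (w : M), ∃ N : ℤ, ∀ n : ℤ, N ≤ n → act u n w = 0
  vacuum_act : ∀ n : ℤ, act A.one n = if n = -1 then (1 : Module.End ℂ M) else 0
  borcherds : ∀ (u v : V) (w : M) (p m n : ℤ),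
    ∑ᶠ i : ℕ, zchoose m i • act (A.Y u (p + i) v) (m + n - i) w
      = ∑ᶠ i : ℕ, ((-1 : ℂ) ^ i * zchoose p i) •
          (act u (m + p - i) (act v (n + i) w)
            - ((-1 : ℂ) ^ p) • act v (n + p - i) (act u (m + i) w))

/-- An admissible (`ℕ`-gradable) module for a vertex operator algebra:
a weak module with an `ℕ`-grading with nonzero top level, compatible with weights. -/
structure AdmMod (A : VOA V) (M : Type) [AddCommGroup M] [Module ℂ M]
    extends WkMod A M : Type where
  gr : ℕ → Submodule ℂ M
  grInternal : DirectSum.IsInternal gr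
  top_ne_bot : gr 0 ≠ ⊥
  gr_mode : ∀ (k : ℤ) (u : V), u ∈ A.wt k → ∀ (m : ℤ) (n : ℕ) (w : M), w ∈ gr n →
    act u m w ∈
      if 0 ≤ (n : ℤ) + k - m - 1 then gr ((n : ℤ) + k - m - 1).toNat else ⊥

/-- An ordinary module for a vertex operator algebra: a weak module on which `L(0)`
acts semisimply with finite dimensional eigenspaces whose weights are truncated from
below in each coset `λ + ℤ`. -/
structure OrdMod (A : VOA V) (M : Type) [AddCommGroup M] [Module ℂ M]
    extends WkMod A M : Type where
  wtm : ℂ → Submodule ℂ M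
  indep : iSupIndep wtm
  spans : ⨆ c : ℂ, wtm c = ⊤
  L0_diag : ∀ (c : ℂ) (w : M), w ∈ wtm c → act A.omega 1 w = c • w
  fdim : ∀ c : ℂ, FiniteDimensional ℂ (wtm c)
  bounded_below : ∀ c : ℂ, ∃ N : ℤ, ∀ m : ℤ, m < N → wtm (c + m) = ⊥

/-- Irreducibility of a weak module. -/
def WkMod.Irreducible {A : VOA V} {M : Type} [AddCommGroup M] [Module ℂ M]
    (P : WkMod A M) : Prop :=
  (∃ w : M, w ≠ 0) ∧
    ∀ U : Submodule ℂ M, (∀ (u : V) (n : ℤ) (w : M), w ∈ U → P.act u n w ∈ U) →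
      U = ⊥ ∨ U = ⊤

/-- Isomorphism of two weak modules over the same vertex operator algebra. -/
def ModIso (A : VOA V) {M N : Type} [AddCommGroup M] [Module ℂ M]
    [AddCommGroup N] [Module ℂ N] (P : WkMod A M) (Q : WkMod A N) : Prop :=
  ∃ f : M ≃ₗ[ℂ] N, ∀ (u : V) (n : ℤ) (w : M), f (P.act u n w) = Q.act u n (f w)

/-- The action of the zero-mode `o(u) = u_{wt u - 1}` (extended linearly from
homogeneous vectors) on a weak module; it preserves the top level of an
admissible module. -/
noncomputable def WkMod.oAct {A : VOA V} {M : Type} [AddCommGroup M] [Module ℂ M]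
    (Q : WkMod A M) (u : V) (w : M) : M :=
  ∑ᶠ k : ℤ, Q.act (A.hcomp k u) (k - 1) w

/-- Action of a word of creation operators `h_{a_1}(-n_1) ⋯ h_{a_k}(-n_k)`. -/
def wordAct {ℓ : ℕ} {M : Type} (f : Fin ℓ → ℤ → M → M) : List (Fin ℓ × ℕ+) → M → M
  | [], w => w
  | (a, n) :: L, w => f a (-((n : ℕ) : ℤ)) (wordAct f L w)

/-- Action of a word of twisted creation operators
`h_{a_1}(-n_1+1/2) ⋯ h_{a_k}(-n_k+1/2)` (indices doubled). -/
def twWordAct {ℓ : ℕ} {M : Type} (f : Fin ℓ → ℤ → M → M) : List (Fin ℓ × ℕ+) → M → M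
  | [], w => w
  | (a, n) :: L, w => f a (-(2 * ((n : ℕ) : ℤ) - 1)) (twWordAct f L w)

/-- `A` is the rank `ℓ` free bosonic (Heisenberg) vertex operator algebra
`𝓗 = M(1)`, with generators `hgen a = h_a(-1)𝟏` for an orthonormal basis
`h_1, …, h_ℓ` of `𝔥`: the generators have weight one, their modes satisfy the
Heisenberg commutation relations `[h_a(m), h_b(n)] = m δ_{ab} δ_{m+n,0}`, the
conformal vector is `ω = (1/2) ∑_a h_a(-1)²𝟏`, and `V` is spanned by the vectors
`h_{a_1}(-n_1) ⋯ h_{a_k}(-n_k)𝟏`. -/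
structure IsHeisenberg {ℓ : ℕ} (A : VOA V) (hgen : Fin ℓ → V) : Prop where
  wt_one : ∀ a, hgen a ∈ A.wt 1
  heis_comm : ∀ (a b : Fin ℓ) (m n : ℤ),
    A.Y (hgen a) m * A.Y (hgen b) n - A.Y (hgen b) n * A.Y (hgen a) m
      = (if a = b ∧ m + n = 0 then (m : ℂ) else 0) • (1 : Module.End ℂ V)
  omega_eq : A.omega
      = (1 / 2 : ℂ) • ∑ a : Fin ℓ, A.Y (hgen a) (-1) (A.Y (hgen a) (-1) A.one)
  span_words : Submodule.span ℂ
      {v : V | ∃ L : List (Fin ℓ × ℕ+),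
        v = wordAct (fun a k w => A.Y (hgen a) k w) L A.one} = ⊤

/-- `θ` is the automorphism of the free bosonic vertex operator algebra induced
by `-1` on `𝔥`. -/
structure IsThetaAut {ℓ : ℕ} (A : VOA V) (hgen : Fin ℓ → V) (θ : V ≃ₗ[ℂ] V) : Prop where
  map_one : θ A.one = A.one
  map_omega : θ A.omega = A.omega
  map_Y : ∀ (u : V) (n : ℤ) (v : V), θ (A.Y u n v) = A.Y (θ u) n (θ v)
  map_gen : ∀ a, θ (hgen a) = -hgen a
  map_wt : ∀ (k : ℤ) (v : V), v ∈ A.wt k → θ v ∈ A.wt k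

/-- `B` (with underlying space `W`, embedded in `V` by `ι`) is the fixed point
vertex operator subalgebra `V^θ` of the involution `θ`. -/
structure IsFixedSubVOA {W : Type} [AddCommGroup W] [Module ℂ W]
    (A : VOA V) (θ : V ≃ₗ[ℂ] V) (B : VOA W) (ι : W →ₗ[ℂ] V) : Prop where
  inj : Function.Injective ι
  range_eq : LinearMap.range ι
      = Module.End.eigenspace (θ.toLinearMap : Module.End ℂ V) 1
  map_one : ι B.one = A.one
  map_omega : ι B.omega = A.omega
  map_Y : ∀ (u : W) (n : ℤ) (v : W), ι (B.Y u n v) = A.Y (ι u) n (ι v)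
  map_wt : ∀ (k : ℤ) (w : W), w ∈ B.wt k ↔ ι w ∈ A.wt k

/-- `P` is (isomorphic to) the Fock module `M(1,λ)` over the rank `ℓ` Heisenberg
vertex operator algebra: it has a nonzero vector `v₀` with `h_a(n)v₀ = 0` for
`n ≥ 1`, `h_a(0)v₀ = λ_a v₀`, which generates `M` under the creation operators. -/
def IsFockModule {ℓ : ℕ} {M : Type} [AddCommGroup M] [Module ℂ M]
    (A : VOA V) (hgen : Fin ℓ → V) (P : WkMod A M) (lam : Fin ℓ → ℂ) : Prop :=
  ∃ v0 : M, v0 ≠ 0 ∧ (∀ (a : Fin ℓ) (n : ℤ), 1 ≤ n → P.act (hgen a) n v0 = 0) ∧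
    (∀ a : Fin ℓ, P.act (hgen a) 0 v0 = lam a • v0) ∧
    Submodule.span ℂ {w : M | ∃ L : List (Fin ℓ × ℕ+),
      w = wordAct (fun a k x => P.act (hgen a) k x) L v0} = ⊤

/-- A weak `θ`-twisted module (for an involution `θ`): the modes are indexed by
`(1/2)ℤ`, encoded here by doubling (so `act u k` is the mode `u_{k/2}`); on the
eigenspace `θ = (-1)^r` only modes with `k ≡ r (mod 2)` act, and the component
form of the twisted Jacobi identity holds. -/
structure TwMod (A : VOA V) (θ : V ≃ₗ[ℂ] V) (M : Type) [AddCommGroup M]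
    [Module ℂ M] : Type where
  act : V →ₗ[ℂ] ℤ → Module.End ℂ M
  trunc : ∀ (u : V) (w : M), ∃ N : ℤ, ∀ n : ℤ, N ≤ n → act u n w = 0
  vacuum_act : ∀ n : ℤ, act A.one n = if n = -2 then (1 : Module.End ℂ M) else 0
  moding : ∀ (u : V) (r : ℤ), θ u = ((-1 : ℂ) ^ r) • u →
    ∀ k : ℤ, (k - r) % 2 ≠ 0 → act u k = 0
  borcherds : ∀ (u v : V) (r s : ℤ), θ u = ((-1 : ℂ) ^ r) • u →
    θ v = ((-1 : ℂ) ^ s) • v → ∀ (w : M) (p K N : ℤ),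
    ∑ᶠ i : ℕ, ((qchoose ((K : ℚ) / 2) i : ℚ) : ℂ) • act (A.Y u (p + i) v) (K + N - 2 * i) w
      = ∑ᶠ i : ℕ, ((-1 : ℂ) ^ i * zchoose p i) •
          (act u (K + 2 * p - 2 * i) (act v (N + 2 * i) w)
            - ((-1 : ℂ) ^ p) • act v (N + 2 * p - 2 * i) (act u (K + 2 * i) w))

/-- Irreducibility of a twisted module. -/
def TwMod.Irreducible {A : VOA V} {θ : V ≃ₗ[ℂ] V} {M : Type} [AddCommGroup M]
    [Module ℂ M] (T : TwMod A θ M) : Prop :=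
  (∃ w : M, w ≠ 0) ∧
    ∀ U : Submodule ℂ M, (∀ (u : V) (k : ℤ) (w : M), w ∈ U → T.act u k w ∈ U) →
      U = ⊥ ∨ U = ⊤

/-- `T` is (isomorphic to) the canonical irreducible `θ`-twisted module
`𝓗(θ) = S(𝔥 ⊗ t^{-1/2}ℂ[t^{-1/2}])` of the rank `ℓ` free bosonic vertex operator
algebra: it has a nonzero vector killed by all modes `h_a(k/2)`, `k ≥ 1`, which
generates it under the twisted creation operators. -/
def IsCanonicalTwMod {ℓ : ℕ} {M : Type} [AddCommGroup M] [Module ℂ M]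
    (A : VOA V) (hgen : Fin ℓ → V) {θ : V ≃ₗ[ℂ] V} (T : TwMod A θ M) : Prop :=
  ∃ v0 : M, v0 ≠ 0 ∧ (∀ (a : Fin ℓ) (k : ℤ), 1 ≤ k → T.act (hgen a) k v0 = 0) ∧
    Submodule.span ℂ {w : M | ∃ L : List (Fin ℓ × ℕ+),
      w = twWordAct (fun a k x => T.act (hgen a) k x) L v0} = ⊤

/-- `σ` is the canonical involution of the twisted module `𝓗(θ)` (acting by
`(-1)^k` on monomials of length `k`): it is an involution compatible with `θ`
through the twisted action and fixing the lowest weight vectors. -/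
def TwInvolution {ℓ : ℕ} {M : Type} [AddCommGroup M] [Module ℂ M]
    (A : VOA V) (hgen : Fin ℓ → V) {θ : V ≃ₗ[ℂ] V} (T : TwMod A θ M)
    (σ : M ≃ₗ[ℂ] M) : Prop :=
  (∀ w : M, σ (σ w) = w) ∧
  (∀ (u : V) (k : ℤ) (w : M), σ (T.act u k w) = T.act (θ u) k (σ w)) ∧
  (∀ v0 : M, (∀ (a : Fin ℓ) (k : ℤ), 1 ≤ k → T.act (hgen a) k v0 = 0) → σ v0 = v0)

/-- The weak `B = V^θ`-module `Q` "is" the eigenspace `V^{(ε)}` of `θ` on `V`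
(e.g. `𝓗⁺` itself for `ε = 1` and `𝓗⁻` for `ε = -1`), with action obtained by
restricting the vertex operators of `V`. -/
def IsEigenPartModule {W N : Type} [AddCommGroup W] [Module ℂ W]
    [AddCommGroup N] [Module ℂ N] (A : VOA V) (θ : V ≃ₗ[ℂ] V) {B : VOA W}
    (ι : W →ₗ[ℂ] V) (ε : ℂ) (Q : WkMod B N) : Prop :=
  ∃ j : N →ₗ[ℂ] V, Function.Injective j ∧
    LinearMap.range j = Module.End.eigenspace (θ.toLinearMap : Module.End ℂ V) ε ∧
    ∀ (u : W) (n : ℤ) (w : N), j (Q.act u n w) = A.Y (ι u) n (j w)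

/-- The weak `B = V^θ`-module `Q` "is" the eigenspace `𝓗(θ)^{(ε)}` of the
involution `σ` on the twisted module `𝓗(θ)`, with the restricted twisted action
(`u ∈ V^θ` acts by its integral modes). -/
def IsTwEigenPartModule {W MT N : Type} [AddCommGroup W] [Module ℂ W]
    [AddCommGroup MT] [Module ℂ MT] [AddCommGroup N] [Module ℂ N]
    (A : VOA V) {θ : V ≃ₗ[ℂ] V} {B : VOA W} (ι : W →ₗ[ℂ] V)
    (T : TwMod A θ MT) (σ : MT ≃ₗ[ℂ] MT) (ε : ℂ) (Q : WkMod B N) : Prop :=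
  ∃ j : N →ₗ[ℂ] MT, Function.Injective j ∧
    LinearMap.range j = Module.End.eigenspace (σ.toLinearMap : Module.End ℂ MT) ε ∧
    ∀ (u : W) (n : ℤ) (w : N), j (Q.act u n w) = T.act (ι u) (2 * n) (j w)

/-- The weak `B = 𝓗⁺`-module `Q` "is" the restriction to `𝓗⁺` of the Fock module
`M(1,λ)`. -/
def IsFockRestriction {ℓ : ℕ} {W N : Type} [AddCommGroup W] [Module ℂ W]
    [AddCommGroup N] [Module ℂ N] (A : VOA V) (hgen : Fin ℓ → V) {B : VOA W}
    (ι : W →ₗ[ℂ] V) (lam : Fin ℓ → ℂ) (Q : WkMod B N) : Prop :=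
  ∃ P : WkMod A N, IsFockModule A hgen P lam ∧
    ∀ (u : W) (n : ℤ), Q.act u n = P.act (ι u) n

/-- A realization of Zhu's algebra `A(V) = V/O(V)` of a vertex operator algebra
as an abstract associative `ℂ`-algebra `R`. -/
structure ZhuRealization (A : VOA V) (R : Type) [Ring R] [Algebra ℂ R] : Type where
  π : V →ₗ[ℂ] R
  surj : Function.Surjective π
  ker_eq : LinearMap.ker π = A.Osub
  map_star : ∀ u v : V, π (A.star u v) = π u * π v
  map_one : π A.one = 1

/-- The `R = A(V)`-module `M` "is" the top level `N(0)` of the admissible module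
`N`, where `[u] ∈ A(V)` acts on the top level by the zero-mode `o(u)`. -/
def IsTopLevelOf {R : Type} [Ring R] [Algebra ℂ R] {A : VOA V}
    (Z : ZhuRealization A R) {N : Type} [AddCommGroup N] [Module ℂ N]
    (Qa : AdmMod A N) (M : Type) [AddCommGroup M] [Module R M] : Prop :=
  ∃ f : M →+ N, Function.Injective f ∧ (∀ m : M, f m ∈ Qa.gr 0) ∧
    (∀ w ∈ Qa.gr 0, ∃ m : M, f m = w) ∧
    ∀ (u : V) (m : M), f (Z.π u • m) = Qa.toWkMod.oAct u (f m)

/-- Iterated Zhu product of a list of elements (an empty product is `[𝟏]`). -/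
noncomputable def starList (A : VOA V) : List V → V
  | [] => A.one
  | x :: L => A.star x (starList A L)

/-- The linear span of all Zhu-monomials in a set of generators; modulo `O(V)`
this is the subalgebra of `A(V)` generated by the images of the generators. -/
def genMonomials (A : VOA V) (gens : Set V) : Submodule ℂ V :=
  Submodule.span ℂ {w : V | ∃ L : List V, (∀ g ∈ L, g ∈ gens) ∧ w = starList A L}

/-- The subspace `𝓦^α ⊆ 𝓗` spanned by the monomials
`h_{a_1}(-n_1) ⋯ h_{a_k}(-n_k)𝟏` whose number of letters from `𝓗_c` is odd
exactly for `c ∈ α`; thus `wordSpanV A hgen ∅ = 𝓦 = 𝓗₁⁺ ⊗ ⋯ ⊗ 𝓗_ℓ⁺`. -/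
def wordSpanV {ℓ : ℕ} (A : VOA V) (hgen : Fin ℓ → V) (α : Finset (Fin ℓ)) :
    Submodule ℂ V :=
  Submodule.span ℂ {v : V | ∃ L : List (Fin ℓ × ℕ+),
    (∀ c : Fin ℓ, c ∈ α ↔ ¬ Even ((L.map Prod.fst).count c)) ∧
    v = wordAct (fun a k w => A.Y (hgen a) k w) L A.one}

/-- The element `S_{ab}(m,n) = h_a(-m)h_b(-n)𝟏` of `𝓗`. -/
def SV {ℓ : ℕ} (A : VOA V) (hgen : Fin ℓ → V) (a b : Fin ℓ) (m n : ℤ) : V :=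
  A.Y (hgen a) (-m) (A.Y (hgen b) (-n) A.one)

/-- The element `ω_a = (1/2) h_a(-1)²𝟏` of `𝓗⁺`. -/
def omegaV {ℓ : ℕ} (A : VOA V) (hgen : Fin ℓ → V) (a : Fin ℓ) : V :=
  (1 / 2 : ℂ) • SV A hgen a a 1 1

/-- The element `J_a = h_a(-1)⁴𝟏 - 2h_a(-3)h_a(-1)𝟏 + (3/2)h_a(-2)²𝟏` of `𝓗⁺`. -/
def JV {ℓ : ℕ} (A : VOA V) (hgen : Fin ℓ → V) (a : Fin ℓ) : V :=
  A.Y (hgen a) (-1) (A.Y (hgen a) (-1) (A.Y (hgen a) (-1) (A.Y (hgen a) (-1) A.one)))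
    - (2 : ℂ) • SV A hgen a a 3 1 + (3 / 2 : ℂ) • SV A hgen a a 2 2

variable {W : Type} [AddCommGroup W] [Module ℂ W]

/-- `E^u_{ab}` (for `a ≠ b`), as a combination of the `S_{ab}(1,m)`. -/
def EuW {ℓ : ℕ} (s : Fin ℓ → Fin ℓ → ℤ → ℤ → W) (a b : Fin ℓ) : W :=
  (5 : ℂ) • s a b 1 2 + (25 : ℂ) • s a b 1 3 + (36 : ℂ) • s a b 1 4 + (16 : ℂ) • s a b 1 5

/-- `E^t_{ab}` (for `a ≠ b`), as a combination of the `S_{ab}(1,m)`. -/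
def EtW {ℓ : ℕ} (s : Fin ℓ → Fin ℓ → ℤ → ℤ → W) (a b : Fin ℓ) : W :=
  (-16 : ℂ) • ((3 : ℂ) • s a b 1 2 + (14 : ℂ) • s a b 1 3 + (19 : ℂ) • s a b 1 4
    + (8 : ℂ) • s a b 1 5)

/-- `Λ_{ab}` (for `a ≠ b`), as a combination of the `S_{ab}(1,m)`. -/
def LamW {ℓ : ℕ} (s : Fin ℓ → Fin ℓ → ℤ → ℤ → W) (a b : Fin ℓ) : W :=
  (45 : ℂ) • s a b 1 2 + (190 : ℂ) • s a b 1 3 + (240 : ℂ) • s a b 1 4 + (96 : ℂ) • s a b 1 5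

/-- The full setting of the paper: `A = 𝓗` is the rank `ℓ` free bosonic vertex
operator algebra with Heisenberg generators `hgen`, `θ` is its `-1` involution,
and `B = 𝓗⁺` is the fixed point vertex operator subalgebra, embedded by `ι`. -/
structure HeisenbergPlusSetting (ℓ : ℕ) (V W : Type) [AddCommGroup V] [Module ℂ V]
    [AddCommGroup W] [Module ℂ W] : Type where
  A : VOA V
  hgen : Fin ℓ → V
  heis : IsHeisenberg A hgen
  θ : V ≃ₗ[ℂ] V
  thetaAut : IsThetaAut A hgen θ
  B : VOA W
  ι : W →ₗ[ℂ] V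
  fixedSub : IsFixedSubVOA A θ B ι

/-- Bundled weak module over a vertex operator algebra. -/
structure ARep (A : VOA V) : Type 1 where
  carrier : Type
  [acg : AddCommGroup carrier]
  [mod : Module ℂ carrier]
  str : WkMod A carrier

attribute [instance] ARep.acg ARep.mod

/-- Bundled admissible module over a vertex operator algebra. -/
structure BRep (A : VOA V) : Type 1 where
  carrier : Type
  [acg : AddCommGroup carrier]
  [mod : Module ℂ carrier]
  adm : AdmMod A carrier

attribute [instance] BRep.acg BRep.mod

/-- Bundled twisted module over a vertex operator algebra with involution. -/
structure TwRep (A : VOA V) (θ : V ≃ₗ[ℂ] V) : Type 1 where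
  carrier : Type
  [acg : AddCommGroup carrier]
  [mod : Module ℂ carrier]
  str : TwMod A θ carrier

attribute [instance] TwRep.acg TwRep.mod

end

open scoped BigOperators DirectSum TensorProduct
namespace HZ
open LaurentPolynomial Filter

/-- Laurent polynomials. -/
abbrev LP := LaurentPolynomial ℂ

/-- Linear extension of a family indexed by `ℤ` to Laurent polynomials. -/
noncomputable def lmap {M : Type*} [AddCommGroup M] [Module ℂ M] (F : ℤ → M) : LP →ₗ[ℂ] M :=
  (Finsupp.linearCombination ℂ F).comp (AddMonoidAlgebra.coeffLinearEquiv ℂ).toLinearMap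

lemma lmap_T {M : Type*} [AddCommGroup M] [Module ℂ M] (F : ℤ → M) (n : ℤ) :
    lmap F (T n) = F n := by
  simp [lmap, T, -single_eq_C_mul_T]

lemma lp_induction {P : LP → Prop} (f : LP) (_h0 : P 0) (hadd : ∀ f g, P f → P g → P (f + g))
    (hsmul : ∀ (c : ℂ) (n : ℤ), P (c • T n)) : P f := by
  refine LaurentPolynomial.induction_on' f hadd ?_
  intro n a
  have := hsmul a n
  rwa [LaurentPolynomial.smul_eq_C_mul] at this

lemma lp_hom_ext {M : Type*} [AddCommGroup M] [Module ℂ M] {F G : LP →ₗ[ℂ] M}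
    (h : ∀ n, F (T n) = G (T n)) : F = G := by
  refine LinearMap.ext fun f => ?_
  induction f using lp_induction with
  | _h0 => simp
  | hadd f g hf hg => simp [hf, hg]
  | hsmul c n => simp [h]

lemma zchoose_eq (m : ℤ) (i : ℕ) : zchoose m i = ((Ring.choose m i : ℤ) : ℂ) := by
  unfold zchoose
  have : ∀ i, qchoose (m : ℚ) i = ((Ring.choose m i : ℤ) : ℚ) := by
    intro i
    induction i with
    | zero => simp [qchoose]
    | succ i ih =>
      have h := Ring.choose_smul_choose m (n := i + 1) (k := i) (by omega)
      simp only [qchoose, ih]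
      have h2 : ((i + 1 : ℕ) : ℤ) * Ring.choose m (i+1) = Ring.choose m i * (m - i) := by
        simpa [Nat.choose_succ_self_right] using h
      have h3 : ((i + 1 : ℚ)) * (Ring.choose m (i+1) : ℤ) = (Ring.choose m i : ℤ) * (m - i) := by
        exact_mod_cast h2
      field_simp
      linarith
  rw [this]; norm_cast

lemma zchoose_zero (m : ℤ) : zchoose m 0 = 1 := by simp [zchoose_eq]
lemma zchoose_one (m : ℤ) : zchoose m 1 = m := by simp [zchoose_eq]
lemma zchoose_nat (k i : ℕ) : zchoose (k : ℤ) i = (k.choose i : ℂ) := by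
  rw [zchoose_eq, Ring.choose_natCast]; simp
lemma zchoose_neg_one (i : ℕ) : zchoose (-1) i = (-1) ^ i := by
  rw [zchoose_eq]
  have : Ring.choose (-1 : ℤ) i = (-1) ^ i := by
    rw [Ring.choose_neg]
    have : (1 : ℤ) + i - 1 = (i : ℕ) := by simp
    rw [this, Ring.choose_natCast]; simp [Int.negOnePow_def, Units.smul_def]
  rw [this]; simp
lemma zchoose_add (m n : ℤ) (i : ℕ) : zchoose (m + n) i
    = ∑ p ∈ Finset.HasAntidiagonal.antidiagonal i, zchoose m p.1 * zchoose n p.2 := by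
  simp only [zchoose_eq, Ring.add_choose_eq i (Commute.all m n)]
  push_cast; rfl
lemma zchoose_succ (q : ℤ) (n : ℕ) : ((n : ℂ) + 1) * zchoose q (n + 1) = q * zchoose (q - 1) n := by
  have h : zchoose q (n+1) * (n + 1) = zchoose q n * (q - n) := by
    unfold zchoose
    simp only [qchoose]
    have : (n : ℂ) + 1 ≠ 0 := by exact_mod_cast Nat.succ_ne_zero n
    push_cast
    field_simp
  have h2 : ∀ n : ℕ, zchoose q n * (q - n) = q * zchoose (q - 1) n := by
    intro n
    have e := zchoose_add (q - 1) 1 n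
    induction n with
    | zero => simp [zchoose_zero]
    | succ n ih =>
      have p1 : zchoose q (n+1) * (n + 1) = zchoose q n * (q - n) := by
        unfold zchoose
        simp only [qchoose]
        have : (n : ℂ) + 1 ≠ 0 := by exact_mod_cast Nat.succ_ne_zero n
        push_cast
        field_simp
      have p2 : zchoose (q-1) (n+1) * (n + 1) = zchoose (q-1) n * (q - 1 - n) := by
        unfold zchoose
        simp only [qchoose]
        have : (n : ℂ) + 1 ≠ 0 := by exact_mod_cast Nat.succ_ne_zero n
        push_cast
        field_simp
      have ih' := ih (zchoose_add (q - 1) 1 n)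
      have h0 : (n : ℂ) + 1 ≠ 0 := by exact_mod_cast Nat.succ_ne_zero n
      apply mul_right_cancel₀ h0
      push_cast
      linear_combination (q - n - 1 : ℂ) * p1 + (q - n - 1 : ℂ) * ih' - (q : ℂ) * p2
  rw [mul_comm, h, h2]

/-- Hasse derivative on Laurent polynomials. -/
noncomputable def D (i : ℕ) : LP →ₗ[ℂ] LP := lmap (fun m => zchoose m i • T (m - i))

lemma D_T (i : ℕ) (n : ℤ) : D i (T n) = zchoose n i • T (n - i) := by simp [D, lmap_T]

lemma D_mul (i : ℕ) (f g : LP) :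
    D i (f * g) = ∑ p ∈ Finset.HasAntidiagonal.antidiagonal i, D p.1 f * D p.2 g := by
  induction f using lp_induction with
  | _h0 => simp
  | hadd f f' hf hf' => simp [add_mul, hf, hf', Finset.sum_add_distrib]
  | hsmul c m =>
    induction g using lp_induction with
    | _h0 => simp
    | hadd g g' hf hf' => simp only [mul_add, map_add, hf, hf', Finset.sum_add_distrib]
    | hsmul d n =>
      simp only [map_smul, smul_mul_smul_comm, ← T_add, D_T, zchoose_add, Finset.sum_smul,
        Finset.smul_sum]
      refine Finset.sum_congr rfl fun p hp => ?_
      have : (i : ℤ) = p.1 + p.2 := by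
        have := Finset.HasAntidiagonal.mem_antidiagonal.mp hp; omega
      have e : m + n - (p.1 + p.2 : ℤ) = (m - p.1) + (n - p.2) := by ring
      rw [this, e]

lemma D_zero (f : LP) : D 0 f = f := by
  have : D 0 = LinearMap.id := lp_hom_ext (fun n => by simp [D_T, zchoose_zero])
  rw [this]; rfl

lemma D_X1 (i : ℕ) : D (i+2) (1 + T 1 : LP) = 0 := by
  rw [map_add, ← T_zero, D_T, D_T]
  have h1 := zchoose_nat 0 (i+2)
  have h2 := zchoose_nat 1 (i+2)
  have : Nat.choose 1 (i+2) = 0 := Nat.choose_eq_zero_of_lt (by omega)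
  rw [this] at h2
  simp only [Nat.cast_zero, Nat.cast_one, Nat.choose_zero_succ] at h1 h2
  simp [h1, h2]

lemma D_X1_one : D 1 (1 + T 1 : LP) = 1 := by
  rw [map_add, ← T_zero, D_T, D_T]
  simp [zchoose_one]

lemma D_pow (k i : ℕ) : D i ((1 + T 1 : LP) ^ k) = (k.choose i : ℂ) • (1 + T 1 : LP) ^ (k - i) := by
  induction k generalizing i with
  | zero =>
    rw [pow_zero, ← T_zero, D_T]
    have h1 := zchoose_nat 0 i
    simp only [Nat.cast_zero] at h1
    cases i <;> simp [h1]
  | succ k ih =>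
    rw [pow_succ, D_mul]
    cases i with
    | zero => simp [D_zero, pow_succ]
    | succ i =>
      rw [Finset.Nat.sum_antidiagonal_eq_sum_range_succ (fun a b => D a ((1 + T 1 : LP)^k) * D b (1+T 1 : LP)),
        Finset.sum_range_succ, Finset.sum_range_succ, Finset.sum_eq_zero]
      · simp only [ih, Nat.sub_self, D_zero]
        have : i + 1 - i = 1 := by omega
        rw [this, D_X1_one, Nat.choose_succ_succ]
        rcases Nat.lt_or_ge i k with h | h
        · have e1 : k + 1 - (i + 1) = k - (i+1) + 1 := by omega
          have e2 : k - i = k - (i+1) + 1 := by omega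
          rw [e1, e2]; push_cast
          rw [add_smul, pow_succ]; simp
        · rw [Nat.choose_eq_zero_of_lt (show k < i + 1 by omega)]
          simp
      · intro j hj
        have hj := Finset.mem_range.mp hj
        obtain ⟨e, he⟩ : ∃ e, i + 1 - j = e + 2 := ⟨i + 1 - j - 2, by omega⟩
        simp [he, D_X1]

end HZ

open scoped BigOperators DirectSum TensorProduct
namespace HZ
open LaurentPolynomial Filter

variable {V : Type} [AddCommGroup V] [Module ℂ V]

/-- `Res_z f(z) Y(u,z)`. -/
noncomputable def res (A : VOA V) (u : V) : LP →ₗ[ℂ] Module.End ℂ V := lmap (A.Y u)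

lemma res_T (A : VOA V) (u : V) (n : ℤ) : res A u (T n) = A.Y u n := by simp [res, lmap_T]

lemma res_add (A : VOA V) (u u' : V) (f : LP) : res A (u + u') f = res A u f + res A u' f := by
  have : res A (u + u') = res A u + res A u' := lp_hom_ext fun n => by simp [res_T]
  rw [this]; rfl

lemma res_smul (A : VOA V) (c : ℂ) (u : V) (f : LP) : res A (c • u) f = c • res A u f := by
  have : res A (c • u) = c • res A u := lp_hom_ext fun n => by simp [res_T]
  rw [this]; rfl

lemma res_zero (A : VOA V) (f : LP) : res A 0 f = 0 := by
  have := res_smul A 0 0 f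
  simpa using this

lemma trunc_nat (A : VOA V) (u v : V) (m : ℤ) : ∀ᶠ i : ℕ in atTop, A.Y u (m + i) v = 0 := by
  obtain ⟨N, hN⟩ := A.trunc u v
  filter_upwards [eventually_ge_atTop (N - m).toNat] with i hi
  exact hN _ (by omega)

lemma finsum_eventually {F : ℕ → V} (h : ∀ᶠ i in atTop, F i = 0) :
    ∀ᶠ N in atTop, ∑ᶠ i, F i = ∑ i ∈ Finset.range N, F i := by
  obtain ⟨N0, h0⟩ := eventually_atTop.mp h
  filter_upwards [eventually_ge_atTop N0] with N hN
  apply finsum_eq_sum_of_support_subset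
  intro i hi
  simp only [Finset.coe_range, Set.mem_Iio]
  by_contra hc
  exact hi (h0 i (by omega))

lemma borch0 (A : VOA V) (u v w : V) (f g : LP) : ∀ᶠ N in atTop,
    ∑ i ∈ Finset.range N, res A (A.Y u i v) (D i f * g) w
      = res A u f (res A v g w) - res A v g (res A u f w) := by
  induction f using lp_induction with
  | _h0 => simp
  | hadd f f' hf hf' =>
    filter_upwards [hf, hf'] with N h1 h2
    simp only [map_add, add_mul, LinearMap.add_apply, Finset.sum_add_distrib, h1, h2]
    abel
  | hsmul c m =>
    induction g using lp_induction with
    | _h0 => simp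
    | hadd f f' hf hf' =>
      filter_upwards [hf, hf'] with N h1 h2
      simp only [map_add, mul_add, LinearMap.add_apply, Finset.sum_add_distrib, h1, h2]
      abel
    | hsmul d n =>
      have hb := A.borcherds u v w 0 m n
      have hR : (∑ᶠ i : ℕ, ((-1 : ℂ) ^ i * zchoose 0 i) •
          (A.Y u (m + 0 - i) (A.Y v (n + i) w)
            - ((-1 : ℂ) ^ (0:ℤ)) • A.Y v (n + 0 - i) (A.Y u (m + i) w)))
            = A.Y u m (A.Y v n w) - A.Y v n (A.Y u m w) := by
        rw [finsum_eq_single _ 0]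
        · simp [zchoose_zero]
        · intro i hi
          have h1 := zchoose_nat 0 i
          obtain ⟨j, rfl⟩ := Nat.exists_eq_succ_of_ne_zero hi
          simp only [Nat.cast_zero, Nat.succ_eq_add_one, Nat.choose_zero_succ] at h1
          simp [h1]
      rw [hR] at hb
      have hz : ∀ᶠ i : ℕ in atTop, zchoose m i • A.Y (A.Y u (0 + i) v) (m + n - i) w = 0 := by
        filter_upwards [trunc_nat A u v 0] with i hi
        rw [hi]; simp
      filter_upwards [finsum_eventually hz] with N hN
      rw [hN] at hb
      simp only [map_smul, D_T, smul_mul_smul_comm, ← T_add, LinearMap.smul_apply, res_T,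
        smul_smul, zero_add] at hb ⊢
      rw [mul_comm d c, ← smul_sub, ← hb, Finset.smul_sum]
      refine Finset.sum_congr rfl fun i _ => ?_
      have e6 : m - (i:ℤ) + n = m + n - i := by ring
      rw [smul_smul, e6]
      congr 1
      ring

lemma borch1 (A : VOA V) (u v w : V) (f g : LP) : ∀ᶠ N in atTop,
    ∑ i ∈ Finset.range N, res A (A.Y u ((i:ℤ) - 1) v) (D i f * g) w
      = ∑ i ∈ Finset.range N, (res A u (f * T (-1 - i)) (res A v (g * T i) w)
          + res A v (g * T (-1 - i)) (res A u (f * T i) w)) := by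
  induction f using lp_induction with
  | _h0 =>
    refine Eventually.of_forall fun N => ?_
    simp only [map_zero, zero_mul, mul_zero, LinearMap.zero_apply, add_zero, Finset.sum_const_zero]
  | hadd f f' hf hf' =>
    filter_upwards [hf, hf'] with N h1 h2
    simp only [map_add, add_mul, LinearMap.add_apply, Finset.sum_add_distrib, h1, h2]
    abel
  | hsmul c m =>
    induction g using lp_induction with
    | _h0 =>
      refine Eventually.of_forall fun N => ?_
      simp only [map_zero, zero_mul, mul_zero, LinearMap.zero_apply, add_zero, Finset.sum_const_zero]
    | hadd f f' hf hf' =>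
      filter_upwards [hf, hf'] with N h1 h2
      simp only [map_add, mul_add, add_mul, LinearMap.add_apply, Finset.sum_add_distrib, h1, h2]
      abel
    | hsmul d n =>
      have hb := A.borcherds u v w (-1) m n
      have hz : ∀ᶠ i : ℕ in atTop, zchoose m i • A.Y (A.Y u (-1 + i) v) (m + n - i) w = 0 := by
        filter_upwards [trunc_nat A u v (-1)] with i hi
        rw [hi]; simp
      have hz' : ∀ᶠ i : ℕ in atTop, ((-1 : ℂ) ^ i * zchoose (-1) i) •
          (A.Y u (m + -1 - i) (A.Y v (n + i) w)
            - ((-1 : ℂ) ^ (-1:ℤ)) • A.Y v (n + -1 - i) (A.Y u (m + i) w)) = 0 := by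
        filter_upwards [trunc_nat A u w m, trunc_nat A v w n] with i hi hi'
        simp [hi, hi']
      filter_upwards [finsum_eventually hz, finsum_eventually hz'] with N hN hN'
      rw [hN, hN'] at hb
      have e1 : ∀ i : ℕ, ((-1 : ℂ) ^ i * zchoose (-1) i) = 1 := fun i => by
        rw [zchoose_neg_one, ← mul_pow]; simp
      have e2 : ((-1 : ℂ) ^ (-1:ℤ)) = -1 := by norm_num
      simp only [e1, e2, one_smul, neg_smul, sub_neg_eq_add] at hb
      simp only [map_smul, D_T, mul_smul_comm, smul_mul_assoc, ← T_add, LinearMap.smul_apply, res_T,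
        smul_smul]
      have e3 : ∀ i : ℕ, m + (-1 - (i:ℤ)) = m + -1 - i := fun i => by ring
      have e4 : ∀ i : ℕ, n + (-1 - (i:ℤ)) = n + -1 - i := fun i => by ring
      simp only [e3, e4, mul_comm d c, ← smul_add, ← Finset.smul_sum]
      rw [← hb, Finset.smul_sum]
      refine Finset.sum_congr rfl fun i _ => ?_
      rw [smul_smul]
      have e5 : (i:ℤ) - 1 = -1 + i := by ring
      have e6 : m - (i:ℤ) + n = m + n - i := by ring
      rw [e5, e6]
      congr 1
      ring

lemma res_trans (A : VOA V) (u : V) (f : LP) : res A (A.Y A.omega 0 u) f = - res A u (D 1 f) := by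
  have : res A (A.Y A.omega 0 u) = -((res A u).comp (D 1)) := lp_hom_ext fun n => by
    simp [res_T, D_T, A.translation, zchoose_one]
  rw [this]; rfl

/-- `1+z` -/
noncomputable abbrev X1 : LP := 1 + T 1

lemma X1_pow (k : ℕ) : X1 ^ k = ∑ i ∈ Finset.range (k + 1), (k.choose i : ℂ) • (T i : LP) := by
  rw [X1, add_comm, add_pow]
  refine Finset.sum_congr rfl fun i _ => ?_
  rw [T_pow, Algebra.smul_def, one_pow, mul_one, mul_one, mul_comm]
  simp only [map_natCast]

lemma finsum_res (A : VOA V) (k : ℕ) (u v : V) (n : ℤ) :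
    ∑ᶠ i : ℕ, zchoose k i • A.Y u ((i : ℤ) + n) v = res A u (X1 ^ k * T n) v := by
  rw [finsum_eq_sum_of_support_subset (s := Finset.range (k+1))]
  · rw [X1_pow, Finset.sum_mul, map_sum, LinearMap.sum_apply]
    refine Finset.sum_congr rfl fun i _ => ?_
    rw [smul_mul_assoc, ← T_add, map_smul, res_T, zchoose_nat]; rfl
  · intro i hi
    simp only [Finset.coe_range, Set.mem_Iio]
    by_contra hc
    apply hi
    simp only
    rw [zchoose_nat, Nat.choose_eq_zero_of_lt (by omega)]
    simp

lemma mulAux_eq (A : VOA V) (k : ℕ) (u v : V) : A.mulAux k u v = res A u (X1 ^ k * T (-1)) v := by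
  rw [← finsum_res]; rfl
lemma circAux_eq (A : VOA V) (k : ℕ) (u v : V) : A.circAux k u v = res A u (X1 ^ k * T (-2)) v := by
  rw [← finsum_res]; rfl

lemma hcomp_of (A : VOA V) {k : ℤ} {u : V} (hu : u ∈ A.wt k) (j : ℤ) :
    A.hcomp j u = if j = k then u else 0 := by
  have : A.decompose u = DirectSum.lof ℂ ℤ (fun n => A.wt n) k ⟨u, hu⟩ := by
    rw [VOA.decompose, LinearEquiv.symm_apply_eq]
    exact (DirectSum.coeLinearMap_lof A.wt k ⟨u, hu⟩).symm
  rw [VOA.hcomp, this]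
  split_ifs with h
  · subst h; simp [DirectSum.lof_apply]
  · rw [DirectSum.lof_eq_of, DirectSum.of_eq_of_ne _ _ _ h]; simp

lemma star_hom (A : VOA V) {k : ℕ} {u : V} (hu : u ∈ A.wt k) (v : V) :
    A.star u v = res A u (X1 ^ k * T (-1)) v := by
  rw [← mulAux_eq, VOA.star, finsum_eq_single _ (k : ℤ)]
  · rw [hcomp_of A hu]; simp
  · intro j hj
    rw [hcomp_of A hu]; simp [hj, VOA.mulAux]

lemma hcomp_add (A : VOA V) (k : ℤ) (u v : V) : A.hcomp k (u + v) = A.hcomp k u + A.hcomp k v := by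
  simp [VOA.hcomp]
lemma hcomp_smul (A : VOA V) (k : ℤ) (c : ℂ) (v : V) : A.hcomp k (c • v) = c • A.hcomp k v := by
  unfold VOA.hcomp; rw [map_smul]; rfl
lemma hcomp_mem (A : VOA V) (k : ℤ) (v : V) : A.hcomp k v ∈ A.wt k := by
  simp [VOA.hcomp]

/-- All weights are nonnegative. -/
def NonnegWt (A : VOA V) : Prop := ∀ k < 0, A.wt k = ⊥

lemma hcomp_finite (A : VOA V) (u : V) : {k | A.hcomp k u ≠ 0}.Finite := by
  classical
  apply Set.Finite.subset (A.decompose u).support.finite_toSet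
  intro k hk
  simp only [Set.mem_ofPred_eq, VOA.hcomp] at hk
  simpa using hk

lemma mulAux_linear (A : VOA V) (hA : NonnegWt A) (k : ℤ) : ∃ F : LP, ∀ u v, 
    A.mulAux k (A.hcomp k u) v = res A (A.hcomp k u) F v := by
  rcases lt_or_ge k 0 with h | h
  · refine ⟨0, fun u v => ?_⟩
    have : A.hcomp k u = 0 := by
      have := hcomp_mem A k u
      rw [hA k h] at this; simpa using this
    simp [this, VOA.mulAux]
  · obtain ⟨n, rfl⟩ := Int.eq_ofNat_of_zero_le h
    exact ⟨X1 ^ n * T (-1), fun u v => mulAux_eq _ _ _ _⟩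

lemma star_fin (A : VOA V) (u v : V) :
    (Function.support fun k => A.mulAux k (A.hcomp k u) v).Finite := by
  apply (hcomp_finite A u).subset
  intro k hk h0
  apply hk
  simp [h0, VOA.mulAux]

lemma star_add_left (A : VOA V) (hA : NonnegWt A) (u u' v : V) :
    A.star (u + u') v = A.star u v + A.star u' v := by
  unfold VOA.star
  rw [← finsum_add_distrib (star_fin A u v) (star_fin A u' v)]
  refine finsum_congr fun k => ?_
  obtain ⟨F, hF⟩ := mulAux_linear A hA k
  rw [hF, hF, hF, hcomp_add, res_add]; rfl

lemma star_smul_left (A : VOA V) (hA : NonnegWt A) (c : ℂ) (u v : V) :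
    A.star (c • u) v = c • A.star u v := by
  unfold VOA.star
  rw [smul_finsum]
  refine finsum_congr fun k => ?_
  obtain ⟨F, hF⟩ := mulAux_linear A hA k
  rw [hF, hF, hcomp_smul, res_smul]; rfl

lemma hom_induction (A : VOA V) (hA : NonnegWt A) {P : V → Prop} (u : V) (h0 : P 0)
    (hadd : ∀ u v, P u → P v → P (u + v)) (hom : ∀ (k : ℕ) u, u ∈ A.wt k → P u) : P u := by
  have hu : u ∈ ⨆ k, A.wt k := by
    rw [A.internal.submodule_iSup_eq_top]; trivial
  induction hu using Submodule.iSup_induction' with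
  | mem k x hx =>
    rcases lt_or_ge k 0 with h | h
    · rw [hA k h] at hx
      rw [(Submodule.mem_bot ℂ).mp hx]; exact h0
    · obtain ⟨n, rfl⟩ := Int.eq_ofNat_of_zero_le h
      exact hom n x hx
  | zero => exact h0
  | add x y _ _ h1 h2 => exact hadd x y h1 h2

lemma star_zero_left (A : VOA V) (hA : NonnegWt A) (v : V) : A.star 0 v = 0 := by
  have := star_smul_left A hA 0 0 v
  simpa using this

lemma star_add_right (A : VOA V) (hA : NonnegWt A) (u v v' : V) :
    A.star u (v + v') = A.star u v + A.star u v' := by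
  induction u using hom_induction A hA with
  | h0 => simp [star_zero_left A hA]
  | hadd u u' h1 h2 => rw [star_add_left A hA, star_add_left A hA, star_add_left A hA, h1, h2]; abel
  | hom k u hu => simp [star_hom A hu]

lemma star_smul_right (A : VOA V) (hA : NonnegWt A) (c : ℂ) (u v : V) :
    A.star u (c • v) = c • A.star u v := by
  induction u using hom_induction A hA with
  | h0 => simp [star_zero_left A hA]
  | hadd u u' h1 h2 => rw [star_add_left A hA, star_add_left A hA, h1, h2]; simp
  | hom k u hu => simp [star_hom A hu]

/-- The star product as a bilinear map. -/
noncomputable def starL (A : VOA V) (hA : NonnegWt A) : V →ₗ[ℂ] V →ₗ[ℂ] V :=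
  LinearMap.mk₂ ℂ A.star (star_add_left A hA) (star_smul_left A hA) (star_add_right A hA)
    (star_smul_right A hA)

lemma starL_apply (A : VOA V) (hA : NonnegWt A) (u v : V) : starL A hA u v = A.star u v := rfl

lemma star_one (A : VOA V) (hA : NonnegWt A) (u : V) : A.star u A.one = u := by
  induction u using hom_induction A hA with
  | h0 => simp [star_zero_left A hA]
  | hadd u u' h1 h2 => rw [star_add_left A hA, h1, h2]
  | hom k u hu =>
    rw [star_hom A hu, X1_pow, Finset.sum_mul, map_sum, LinearMap.sum_apply,
      Finset.sum_eq_single 0]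
    · simp [res_T, A.create]
    · intro i _ hi
      rw [smul_mul_assoc, ← T_add, map_smul, res_T, LinearMap.smul_apply, A.create_ge _ _ (by omega)]
      simp
    · simp

end HZ

open scoped BigOperators DirectSum TensorProduct
namespace HZ
open LaurentPolynomial Filter

variable {V : Type} [AddCommGroup V] [Module ℂ V]

/-- Span of `z^{-2-n}`, `n ≥ 0`. -/
noncomputable def Nn : Submodule ℂ LP := Submodule.span ℂ (Set.range fun n : ℕ => (T (-2 - n) : LP))

/-- `1 + z⁻¹` -/
noncomputable abbrev U1 : LP := 1 + T (-1)

lemma U1_mul {f : LP} (hf : f ∈ Nn) : f * U1 ∈ Nn := by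
  induction hf using Submodule.span_induction with
  | mem x hx =>
    obtain ⟨n, rfl⟩ := hx
    simp only [mul_add, mul_one, ← T_add]
    refine Submodule.add_mem _ (Submodule.subset_span ⟨n, rfl⟩) (Submodule.subset_span ⟨n + 1, ?_⟩)
    simp only
    congr 1; push_cast; ring
  | zero => simp
  | add x y _ _ h1 h2 => rw [add_mul]; exact Submodule.add_mem _ h1 h2
  | smul c x _ h => rw [smul_mul_assoc]; exact Submodule.smul_mem _ _ h

lemma N2_pow (m : ℕ) : T (-2) * U1 ^ m ∈ Nn := by
  induction m with
  | zero => exact Submodule.subset_span ⟨0, by simp⟩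
  | succ m ih => rw [pow_succ, ← mul_assoc]; exact U1_mul ih

lemma N1_pow (m : ℕ) : T (-1) * U1 ^ m - T (-1) ∈ Nn := by
  induction m with
  | zero => simp
  | succ m ih =>
    have h1 := U1_mul ih
    have h2 : T (-2) ∈ Nn := Submodule.subset_span ⟨0, by simp⟩
    have h3 := Submodule.add_mem _ h1 h2
    convert h3 using 1
    have : (T (-2) : LP) = T (-1) * T (-1) := by rw [← T_add]; norm_num
    rw [this]; ring

lemma zhu_T (A : VOA V) (n k : ℕ) (u : V) (hu : u ∈ A.wt k) (v : V) :
    res A u (X1 ^ k * T (-2 - n)) v ∈ A.Osub := by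
  induction n generalizing k u with
  | zero =>
    have : res A u (X1 ^ k * T (-2 - (0:ℕ))) v = A.circAux k u v := by
      rw [circAux_eq]; simp
    rw [this]
    exact Submodule.subset_span ⟨k, u, v, hu, rfl⟩
  | succ n ih =>
    have hw : A.Y A.omega 0 u ∈ A.wt ((k + 1 : ℕ) : ℤ) := by
      have := A.mode_wt 2 A.omega A.omega_wt k 0 u hu
      convert this using 2; push_cast; ring
    have h1 := ih (k + 1) _ hw
    have h2 := ih k u hu
    have hD : D 1 (X1 ^ (k+1) * T (-2 - n)) = (k + 1 : ℂ) • (X1 ^ k * T (-2 - n))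
        - (2 + n : ℂ) • (X1 ^ k * T (-2 - n)) - (2 + n : ℂ) • (X1 ^ k * T (-2 - (n + 1 : ℕ))) := by
      rw [D_mul]
      have : Finset.HasAntidiagonal.antidiagonal 1 = {((0:ℕ),(1:ℕ)), (1,0)} := rfl
      rw [this, Finset.sum_pair (by simp)]
      simp only [D_zero]
      simp only [D_T, zchoose_one]
      rw [D_pow]
      have e1 : (T (-2 - (n:ℤ)) : LP) = T 1 * T (-2 - (n + 1 : ℕ)) := by
        rw [← T_add]; congr 1; push_cast; ring
      have e2 : -2 - (n:ℤ) - (1 : ℕ) = -2 - (n + 1 : ℕ) := by push_cast; ring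
      rw [e1, e2, pow_succ, Nat.choose_one_right, Nat.add_sub_cancel]
      simp only [LaurentPolynomial.smul_eq_C_mul]
      simp only [map_sub, map_add, map_neg, map_natCast, map_ofNat, Nat.cast_add, Nat.cast_one, map_one,
        Int.cast_sub, Int.cast_neg, Int.cast_ofNat, Int.cast_natCast]
      ring
    rw [res_trans, hD] at h1
    simp only [map_sub, map_smul, LinearMap.neg_apply, LinearMap.sub_apply, LinearMap.smul_apply] at h1
    have h3 : (2 + n : ℂ) • res A u (X1 ^ k * T (-2 - (n + 1 : ℕ))) v ∈ A.Osub := by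
      have := Submodule.add_mem _ h1 (Submodule.smul_mem _ ((k : ℂ) + 1 - (2 + n)) h2)
      convert this using 1
      module
    have hne : (2 + n : ℂ) ≠ 0 := by
      have : ((2 + n : ℕ) : ℂ) ≠ 0 := by exact_mod_cast (by omega)
      simpa using this
    exact (Submodule.smul_mem_iff _ hne).mp h3

lemma zhu_N (A : VOA V) (k : ℕ) (u : V) (hu : u ∈ A.wt k) (v : V) {f : LP} (hf : f ∈ Nn) :
    res A u (X1 ^ k * f) v ∈ A.Osub := by
  induction hf using Submodule.span_induction with
  | mem x hx =>
    obtain ⟨n, rfl⟩ := hx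
    exact zhu_T A n k u hu v
  | zero => simp
  | add x y _ _ h1 h2 => rw [mul_add, map_add]; exact Submodule.add_mem _ h1 h2
  | smul c x _ h => rw [mul_smul_comm, map_smul]; exact Submodule.smul_mem _ _ h

lemma star_hom_sum (A : VOA V) {k : ℕ} {u : V} (hu : u ∈ A.wt k) (v : V) {N : ℕ} (hN : k + 1 ≤ N) :
    A.star u v = ∑ i ∈ Finset.range N, (k.choose i : ℂ) • A.Y u ((i:ℤ) - 1) v := by
  rw [star_hom A hu, X1_pow, Finset.sum_mul, map_sum, LinearMap.sum_apply]
  rw [← Finset.sum_subset (Finset.range_mono hN)]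
  · refine Finset.sum_congr rfl fun i _ => ?_
    rw [smul_mul_assoc, ← T_add, map_smul, res_T]; rfl
  · intro i _ hi
    rw [Nat.choose_eq_zero_of_lt (by simpa using hi)]; simp

lemma assoc_hom (A : VOA V) (hA : NonnegWt A) {k l : ℕ} {u v : V} (hu : u ∈ A.wt k) (hv : v ∈ A.wt l)
    (w : V) : A.star (A.star u v) w - A.star u (A.star v w) ∈ A.Osub := by
  obtain ⟨N, hN, hk⟩ := ((borch1 A u v w (X1 ^ k) (X1 ^ l * T (-1))).and
    (eventually_ge_atTop (k+1))).exists
  have hL : A.star (A.star u v) w = ∑ i ∈ Finset.range N,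
      res A (A.Y u ((i:ℤ) - 1) v) (D i (X1 ^ k) * (X1 ^ l * T (-1))) w := by
    rw [star_hom_sum A hu v hk, ← starL_apply A hA, map_sum, LinearMap.sum_apply]
    refine Finset.sum_congr rfl fun i _ => ?_
    rw [map_smul, LinearMap.smul_apply, starL_apply, D_pow, smul_mul_assoc, map_smul,
      LinearMap.smul_apply]
    rcases Nat.lt_or_ge k i with h | h
    · rw [Nat.choose_eq_zero_of_lt h]; simp
    · have hw : A.Y u ((i:ℤ) - 1) v ∈ A.wt ((k + l - i : ℕ) : ℤ) := by
        have := A.mode_wt k u hu l ((i:ℤ) - 1) v hv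
        convert this using 2
        omega
      rw [star_hom A hw, ← mul_assoc, ← pow_add]
      congr 5
      omega
  rw [hL, hN]
  obtain ⟨M, rfl⟩ : ∃ M, N = M + 1 := ⟨N - 1, by omega⟩
  rw [Finset.sum_range_succ']
  have h0 : res A u (X1 ^ k * T (-1 - ((0:ℕ):ℤ))) (res A v (X1 ^ l * T (-1) * T ((0:ℕ):ℤ)) w)
    = A.star u (A.star v w) := by
    rw [star_hom A hu, star_hom A hv]; simp
  rw [h0, add_sub_assoc, add_sub_cancel_left]
  refine Submodule.add_mem _ (Submodule.sum_mem _ fun i _ => Submodule.add_mem _ ?_ ?_) ?_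
  · have : (-1 - ((i+1:ℕ):ℤ)) = -2 - i := by push_cast; ring
    rw [this]; exact zhu_T A i k u hu _
  · have : (X1 ^ l * T (-1) * T (-1 - ((i+1:ℕ):ℤ)) : LP) = X1 ^ l * T (-2 - ((i+1:ℕ):ℤ)) := by
      rw [mul_assoc, ← T_add]; congr 2; ring
    rw [this]; exact zhu_T A _ l v hv _
  · have : (X1 ^ l * T (-1) * T (-1 - ((0:ℕ):ℤ)) : LP) = X1 ^ l * T (-2 - ((0:ℕ):ℤ)) := by
      rw [mul_assoc, ← T_add]; congr 2
    rw [this]; exact zhu_T A _ l v hv _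

lemma assoc (A : VOA V) (hA : NonnegWt A) (u v w : V) :
    A.star (A.star u v) w - A.star u (A.star v w) ∈ A.Osub := by
  induction u using hom_induction A hA with
  | h0 => simp [star_zero_left A hA]
  | hadd u u' h1 h2 =>
    simp only [star_add_left A hA]
    convert Submodule.add_mem _ h1 h2 using 1
    abel
  | hom k u hu =>
    induction v using hom_induction A hA with
    | h0 => 
      simp only [← starL_apply A hA, map_zero, LinearMap.zero_apply, sub_zero]
      exact Submodule.zero_mem _
    | hadd v v' h1 h2 =>
      simp only [star_add_left A hA, star_add_right A hA]
      convert Submodule.add_mem _ h1 h2 using 1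
      abel
    | hom l v hv => exact assoc_hom A hA hu hv w

lemma core_pow (j e k l : ℕ) (hj : j ≤ k) (h : j + e + 1 ≤ k + l) :
    X1 ^ (k - j) * X1 ^ l * T (-1 - (e:ℤ)) = X1 ^ (k + l - 1 - (j + e)) * U1 ^ (e + 1) := by
  have hU : U1 = X1 * T (-1) := by
    rw [add_mul, ← T_add]; simp [add_comm]
  rw [hU, mul_pow, T_pow, ← mul_assoc, ← pow_add, ← pow_add]
  congr 2
  · omega
  · push_cast; ring

/-- auxiliary Laurent polynomial in the commutator formula -/
noncomputable def Q (k i : ℕ) : LP :=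
  ∑ p ∈ Finset.HasAntidiagonal.antidiagonal i, ((k.choose p.1 : ℂ) * (-1) ^ p.2) • U1 ^ (p.2 + 1)

lemma core_D (i k l : ℕ) (h : i + 1 ≤ k + l) (q : ℤ) :
    D i (X1 ^ k * T (-1)) * (X1 ^ l * T q) = X1 ^ (k + l - 1 - i) * (T q * Q k i) := by
  rw [D_mul, Q, Finset.sum_mul, Finset.mul_sum, Finset.mul_sum]
  refine Finset.sum_congr rfl fun p hp => ?_
  have hp := Finset.HasAntidiagonal.mem_antidiagonal.mp hp
  rw [D_pow, D_T, zchoose_neg_one]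
  rcases Nat.lt_or_ge k p.1 with h' | h'
  · rw [Nat.choose_eq_zero_of_lt h']; simp
  · have := core_pow p.1 p.2 k l h' (by omega)
    rw [hp] at this
    simp only [smul_mul_assoc, mul_smul_comm, smul_smul]
    rw [mul_comm ((-1 : ℂ) ^ _)]
    congr 1
    calc _ = (X1 ^ (k - p.1) * X1 ^ l * T (-1 - (p.2:ℤ))) * T q := by ring
      _ = _ := by rw [this]; ring

/-- coefficients in the commutator formula -/
noncomputable def cc (k i : ℕ) : ℂ :=
  ∑ p ∈ Finset.HasAntidiagonal.antidiagonal i, ((k.choose p.1 : ℂ) * (-1) ^ p.2)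

lemma cc_zero (k : ℕ) : cc k 0 = 1 := by simp [cc]
lemma cc_succ (k i : ℕ) : cc k (i + 1) = k.choose (i + 1) - cc k i := by
  rw [cc, Finset.Nat.sum_antidiagonal_succ', cc]
  simp [pow_succ, Finset.sum_neg_distrib, sub_eq_add_neg]
  
lemma cc_two (i : ℕ) : cc 2 (i + 2) = 0 := by
  induction i with
  | zero => norm_num [cc_succ, cc_zero]
  | succ i ih => rw [cc_succ, ih, Nat.choose_eq_zero_of_lt (by omega)]; simp

lemma NQ2 (k i : ℕ) : T (-2) * Q k i ∈ Nn := by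
  rw [Q, Finset.mul_sum]
  refine Submodule.sum_mem _ fun p _ => ?_
  rw [mul_smul_comm]
  exact Submodule.smul_mem _ _ (N2_pow _)

lemma NQ1 (k i : ℕ) : T (-1) * Q k i - cc k i • T (-1) ∈ Nn := by
  rw [Q, Finset.mul_sum, cc, Finset.sum_smul, ← Finset.sum_sub_distrib]
  refine Submodule.sum_mem _ fun p _ => ?_
  rw [mul_smul_comm, ← smul_sub]
  exact Submodule.smul_mem _ _ (N1_pow _)

lemma wt_mode_nat (A : VOA V) (hA : NonnegWt A) {k l : ℕ} {u v : V} (hu : u ∈ A.wt k)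
    (hv : v ∈ A.wt l) (i : ℕ) : 
    (k + l < i + 1 ∧ A.Y u i v = 0) ∨ 
      (i + 1 ≤ k + l ∧ A.Y u i v ∈ A.wt ((k + l - 1 - i : ℕ) : ℤ)) := by
  have h := A.mode_wt k u hu l i v hv
  rcases Nat.lt_or_ge (k + l) (i + 1) with h' | h'
  · rw [hA _ (by omega)] at h
    exact Or.inl ⟨h', (Submodule.mem_bot ℂ).mp h⟩
  · refine Or.inr ⟨h', ?_⟩
    convert h using 2
    omega

lemma left_ideal (A : VOA V) (hA : NonnegWt A) (u : V) {x : V} (hx : x ∈ A.Osub) :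
    A.star u x ∈ A.Osub := by
  induction u using hom_induction A hA with
  | h0 => rw [star_zero_left A hA]; exact Submodule.zero_mem _
  | hadd u u' h1 h2 => rw [star_add_left A hA]; exact Submodule.add_mem _ h1 h2
  | hom k u hu =>
    induction hx using Submodule.span_induction with
    | zero => rw [← starL_apply A hA, map_zero]; exact Submodule.zero_mem _
    | add x y _ _ h1 h2 => rw [star_add_right A hA]; exact Submodule.add_mem _ h1 h2
    | smul c x _ h => rw [star_smul_right A hA]; exact Submodule.smul_mem _ _ h
    | mem x hx =>
      obtain ⟨l, v, w, hv, rfl⟩ := hx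
      rcases lt_or_ge l 0 with h | h
      · rw [hA l h] at hv
        have : A.circAux l v w = 0 := by simp [(Submodule.mem_bot ℂ).mp hv, VOA.circAux]
        rw [this, ← starL_apply A hA, map_zero]; exact Submodule.zero_mem _
      · obtain ⟨l, rfl⟩ := Int.eq_ofNat_of_zero_le h
        change v ∈ A.wt (l : ℤ) at hv
        change A.star u (A.circAux (l : ℤ) v w) ∈ _
        rw [star_hom A hu, circAux_eq]
        obtain ⟨N, hN⟩ := (borch0 A u v w (X1 ^ k * T (-1)) (X1 ^ l * T (-2))).exists
        rw [eq_comm, sub_eq_iff_eq_add] at hN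
        rw [hN]
        refine Submodule.add_mem _ (Submodule.sum_mem _ fun i _ => ?_) ?_
        · rcases wt_mode_nat A hA hu hv i with ⟨_, h0⟩ | ⟨hi, hw⟩
          · rw [h0, res_zero]; exact Submodule.zero_mem _
          · rw [core_D i k l hi]
            exact zhu_N A _ _ hw _ (NQ2 k i)
        · have := zhu_T A 0 l v hv (res A u (X1 ^ k * T (-1)) w)
          simpa using this

lemma comm_hom (A : VOA V) (hA : NonnegWt A) {k l : ℕ} {u v : V} (hu : u ∈ A.wt k) (hv : v ∈ A.wt l)
    (w : V) : ∀ᶠ N in atTop, A.star u (A.star v w) - A.star v (A.star u w)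
      - ∑ i ∈ Finset.range N, cc k i • A.star (A.Y u (i:ℕ) v) w ∈ A.Osub := by
  filter_upwards [borch0 A u v w (X1 ^ k * T (-1)) (X1 ^ l * T (-1))] with N hN
  rw [star_hom A hu, star_hom A hv, star_hom A hu, star_hom A hv, ← hN, ← Finset.sum_sub_distrib]
  refine Submodule.sum_mem _ fun i _ => ?_
  rcases wt_mode_nat A hA hu hv i with ⟨_, h0⟩ | ⟨hi, hw⟩
  · rw [h0, res_zero, star_zero_left A hA]; simp
  · rw [core_D i k l hi, star_hom A hw, ← LinearMap.smul_apply, ← LinearMap.sub_apply, ← map_smul,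
      ← map_sub, ← mul_smul_comm, ← mul_sub]
    exact zhu_N A _ _ hw _ (NQ1 k i)

lemma comm_two (A : VOA V) (hA : NonnegWt A) {u : V} (hu : u ∈ A.wt 2) (v w : V) :
    A.star u (A.star v w) - A.star v (A.star u w)
      - A.star (A.Y u 0 v + A.Y u 1 v) w ∈ A.Osub := by
  induction v using hom_induction A hA with
  | h0 =>
    simp only [← starL_apply A hA, map_zero, LinearMap.zero_apply, sub_zero, add_zero]
    exact Submodule.zero_mem _
  | hadd v v' h1 h2 =>
    simp only [← starL_apply A hA, map_add, LinearMap.add_apply] at h1 h2 ⊢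
    convert Submodule.add_mem _ h1 h2 using 1
    abel
  | hom l v hv =>
    obtain ⟨N, hN, h2⟩ := ((comm_hom A hA (k := 2) hu hv w).and (eventually_ge_atTop 2)).exists
    obtain ⟨M, rfl⟩ : ∃ M, N = M + 2 := ⟨N - 2, by omega⟩
    have c1 : cc 2 1 = 1 := by norm_num [cc_succ, cc_zero]
    rw [Finset.sum_range_succ', Finset.sum_range_succ', Finset.sum_eq_zero] at hN
    · simpa [c1, cc_zero, star_add_left A hA, add_comm, -map_add] using hN
    · intro i _
      rw [cc_two]; simp

lemma circ_star (A : VOA V) (hA : NonnegWt A) {k : ℕ} {u : V} (hu : u ∈ A.wt k) (v : V) :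
    A.star (A.Y A.omega 0 u + (k : ℂ) • u) v = A.circAux k u v := by
  have hw : A.Y A.omega 0 u ∈ A.wt ((k + 1 : ℕ) : ℤ) := by
    have := A.mode_wt 2 A.omega A.omega_wt k 0 u hu
    convert this using 2; push_cast; ring
  rw [star_add_left A hA, star_smul_left A hA, star_hom A hw, star_hom A hu, circAux_eq, res_trans,
    ← LinearMap.smul_apply, ← map_smul, ← map_neg, ← LinearMap.add_apply, ← map_add]
  congr 2
  rw [D_mul]
  have : Finset.HasAntidiagonal.antidiagonal 1 = {((0:ℕ),(1:ℕ)), (1,0)} := rfl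
  rw [this, Finset.sum_pair (by simp)]
  simp only [D_zero]
  simp only [D_T, zchoose_one]
  rw [D_pow]
  have e1 : (T (-1) : LP) = T 1 * T (-2) := by rw [← T_add]; norm_num
  have e2 : (-1 : ℤ) - (1 : ℕ) = -2 := by norm_num
  rw [e2, e1, pow_succ, Nat.choose_one_right, Nat.add_sub_cancel]
  simp only [LaurentPolynomial.smul_eq_C_mul]
  simp only [map_sub, map_add, map_neg, map_natCast, map_ofNat, Nat.cast_add, Nat.cast_one, map_one,
    Int.cast_sub, Int.cast_neg, Int.cast_ofNat, Int.cast_natCast, Int.cast_one]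
  ring

lemma right_ideal (A : VOA V) (hA : NonnegWt A) (w : V) {x : V} (hx : x ∈ A.Osub) :
    A.star x w ∈ A.Osub := by
  induction hx using Submodule.span_induction with
  | zero => rw [star_zero_left A hA]; exact Submodule.zero_mem _
  | add x y _ _ h1 h2 => rw [star_add_left A hA]; exact Submodule.add_mem _ h1 h2
  | smul c x _ h => rw [star_smul_left A hA]; exact Submodule.smul_mem _ _ h
  | mem x hx =>
    obtain ⟨l, v, x, hv, rfl⟩ := hx
    rcases lt_or_ge l 0 with h | h
    · rw [hA l h] at hv
      have : A.circAux l v x = 0 := by simp [(Submodule.mem_bot ℂ).mp hv, VOA.circAux]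
      rw [this, star_zero_left A hA]; exact Submodule.zero_mem _
    · obtain ⟨l, rfl⟩ := Int.eq_ofNat_of_zero_le h
      change v ∈ A.wt (l : ℤ) at hv
      change A.star (A.circAux (l : ℤ) v x) w ∈ _
      rw [← circ_star A hA hv]
      have h1 := assoc A hA (A.Y A.omega 0 v + (l : ℂ) • v) x w
      rw [circ_star A hA hv (A.star x w)] at h1
      have h2 : A.circAux l v (A.star x w) ∈ A.Osub := Submodule.subset_span ⟨l, v, _, hv, rfl⟩
      simpa using Submodule.add_mem _ h1 h2

end HZ

open scoped BigOperators DirectSum TensorProduct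
namespace HZ
open LaurentPolynomial Filter

variable {V : Type} [AddCommGroup V] [Module ℂ V]

lemma zchoose_zero_succ (i : ℕ) : zchoose 0 (i + 1) = 0 := by
  have := zchoose_nat 0 (i + 1)
  simpa using this

/-- commutator formula -/
lemma comm_finsum (A : VOA V) (u v w : V) (m n : ℤ) :
    A.Y u m (A.Y v n w) - A.Y v n (A.Y u m w)
      = ∑ᶠ i : ℕ, zchoose m i • A.Y (A.Y u i v) (m + n - i) w := by
  have h := A.borcherds u v w 0 m n
  simp only [zero_add] at h
  rw [h, finsum_eq_single _ 0]
  · simp [zchoose_zero]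
  · intro i hi
    obtain ⟨j, rfl⟩ := Nat.exists_eq_succ_of_ne_zero hi
    simp [zchoose_zero_succ]

lemma om0 (A : VOA V) (u v : V) (n : ℤ) :
    A.Y A.omega 0 (A.Y u n v) = A.Y u n (A.Y A.omega 0 v) - (n : ℂ) • A.Y u (n - 1) v := by
  have h := comm_finsum A A.omega u v 0 n
  rw [finsum_eq_single _ 0] at h
  · rw [sub_eq_iff_eq_add] at h
    rw [h, zchoose_zero]
    simp only [Nat.cast_zero, A.translation, sub_zero, zero_add, one_smul, LinearMap.smul_apply]
    module
  · intro i hi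
    obtain ⟨j, rfl⟩ := Nat.exists_eq_succ_of_ne_zero hi
    simp [zchoose_zero_succ]

lemma om0_one (A : VOA V) : A.Y A.omega 0 A.one = 0 := A.create_ge _ _ le_rfl

lemma Y_neg_two_one (A : VOA V) (u : V) : A.Y u (-2) A.one = A.Y A.omega 0 u := by
  have h := A.translation u (-1)
  have h2 := A.create (A.Y A.omega 0 u)
  rw [h] at h2
  rw [← h2]; norm_num

section heis
variable {ℓ : ℕ} {A : VOA V} {hgen : Fin ℓ → V}

lemma h_comm (H : IsHeisenberg A hgen) (a b : Fin ℓ) (m n : ℤ) (v : V) :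
    A.Y (hgen a) m (A.Y (hgen b) n v) = A.Y (hgen b) n (A.Y (hgen a) m v)
      + (if a = b ∧ m + n = 0 then (m : ℂ) else 0) • v := by
  have := LinearMap.congr_fun (H.heis_comm a b m n) v
  simp only [LinearMap.sub_apply, Module.End.mul_apply, LinearMap.smul_apply,
    Module.End.one_apply] at this
  rw [← this]; abel

lemma h_comm0 (H : IsHeisenberg A hgen) (a b : Fin ℓ) (m n : ℤ) (hmn : m + n ≠ 0) (v : V) :
    A.Y (hgen a) m (A.Y (hgen b) n v) = A.Y (hgen b) n (A.Y (hgen a) m v) := by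
  rw [h_comm H]; simp [hmn]

lemma SV_comm (H : IsHeisenberg A hgen) (a b : Fin ℓ) (m n : ℤ) (h : m + n ≠ 0) :
    SV A hgen a b m n = SV A hgen b a n m := h_comm0 H _ _ _ _ (by omega) _

/-- modes of `h_b` on `ω_a`. -/
lemma h_omega (H : IsHeisenberg A hgen) (a b : Fin ℓ) (i : ℕ) :
    A.Y (hgen b) i (omegaV A hgen a) = if i = 1 ∧ a = b then hgen a else 0 := by
  unfold omegaV SV
  rw [map_smul, h_comm H, h_comm H b a i (-1) A.one, A.create_ge (hgen b) i (by omega)]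
  have : A.Y (hgen a) (-1) A.one = hgen a := A.create _
  simp only [map_add, map_smul, map_zero, zero_add, this]
  by_cases hi : i = 1
  · subst hi
    by_cases hab : a = b
    · subst hab; simp; module
    · have : ¬ b = a := fun h => hab h.symm
      simp [hab, this]
  · have : ¬ ((i : ℤ) + -1 = 0) := by omega
    simp [hi, this]

lemma h_omega_comm (H : IsHeisenberg A hgen) (a b : Fin ℓ) (m q : ℤ) (w : V) :
    A.Y (omegaV A hgen a) q (A.Y (hgen b) m w) = A.Y (hgen b) m (A.Y (omegaV A hgen a) q w)
      - (if a = b then (m : ℂ) else 0) • A.Y (hgen b) (m + q - 1) w := by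
  have h := comm_finsum A (hgen b) (omegaV A hgen a) w m q
  rw [finsum_eq_single _ 1] at h
  · rw [h_omega H, zchoose_one] at h
    rw [eq_sub_iff_add_eq, add_comm, ← eq_sub_iff_add_eq, h]
    by_cases hab : a = b
    · subst hab; simp
    · simp [hab]
  · intro i hi
    rw [h_omega H]; simp [hi]

lemma omega_S_same (H : IsHeisenberg A hgen) (a : Fin ℓ) (m n q : ℤ) :
    A.Y (omegaV A hgen a) q (SV A hgen a a m n)
      = A.Y (hgen a) (-m) (A.Y (hgen a) (-n) (A.Y (omegaV A hgen a) q A.one))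
        + (n : ℂ) • SV A hgen a a m (n - q + 1) + (m : ℂ) • SV A hgen a a (m - q + 1) n := by
  unfold SV
  rw [h_omega_comm H, h_omega_comm H]
  have e1 : -m + q - 1 = -(m - q + 1) := by ring
  have e2 : -n + q - 1 = -(n - q + 1) := by ring
  rw [e1, e2]
  simp only [map_sub, map_smul, if_true, Int.cast_neg]
  module

lemma omega_S_left (H : IsHeisenberg A hgen) {a b : Fin ℓ} (hab : a ≠ b) (m n q : ℤ) (hq : 0 ≤ q) :
    A.Y (omegaV A hgen a) q (SV A hgen a b m n) = (m : ℂ) • SV A hgen a b (m - q + 1) n := by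
  unfold SV
  rw [h_omega_comm H, h_omega_comm H, A.create_ge _ _ hq]
  have e1 : -m + q - 1 = -(m - q + 1) := by ring
  rw [e1]
  simp [hab]

lemma omega_S_right (H : IsHeisenberg A hgen) {a b : Fin ℓ} (hab : a ≠ b) (m n q : ℤ) (hq : 0 ≤ q) :
    A.Y (omegaV A hgen b) q (SV A hgen a b m n) = (n : ℂ) • SV A hgen a b m (n - q + 1) := by
  unfold SV
  rw [h_omega_comm H, h_omega_comm H, A.create_ge _ _ hq]
  have e1 : -n + q - 1 = -(n - q + 1) := by ring
  rw [e1]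
  simp [hab.symm]

lemma om0_S (a b : Fin ℓ) (m n : ℤ) :
    A.Y A.omega 0 (SV A hgen a b m n) = (m : ℂ) • SV A hgen a b (m + 1) n
      + (n : ℂ) • SV A hgen a b m (n + 1) := by
  unfold SV
  rw [om0, om0, om0_one]
  have e1 : -m - 1 = -(m + 1) := by ring
  have e2 : -n - 1 = -(n + 1) := by ring
  rw [e1, e2]
  simp only [map_sub, map_smul, map_zero, Int.cast_neg]
  module

lemma omega_neg_two (H : IsHeisenberg A hgen) (a : Fin ℓ) :
    A.Y (omegaV A hgen a) (-2) A.one = SV A hgen a a 2 1 := by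
  rw [Y_neg_two_one]
  conv_lhs => rw [omegaV]
  rw [map_smul, om0_S, SV_comm H a a 1 (1 + 1) (by norm_num)]
  norm_num
  module

lemma SV_wt (H : IsHeisenberg A hgen) (a b : Fin ℓ) (m n : ℤ) : SV A hgen a b m n ∈ A.wt (m + n) := by
  have h1 := A.mode_wt 1 _ (H.wt_one b) 0 (-n) _ A.one_wt
  have h2 := A.mode_wt 1 _ (H.wt_one a) _ (-m) _ h1
  unfold SV
  convert h2 using 2; ring

lemma omegaV_wt (H : IsHeisenberg A hgen) (a : Fin ℓ) : omegaV A hgen a ∈ A.wt 2 :=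
  Submodule.smul_mem _ _ (SV_wt H a a 1 1)

/-- The closure properties of the image of the submodule `T`. -/
structure Good (A : VOA V) (hgen : Fin ℓ → V) (R P : Submodule ℂ V) : Prop where
  comm : ∀ a, ∀ v ∈ P, A.Y (omegaV A hgen a) 0 v + A.Y (omegaV A hgen a) 1 v ∈ P
  circ : ∀ a, ∀ v ∈ R, A.Y (omegaV A hgen a) (-2) v + (2 : ℂ) • A.Y (omegaV A hgen a) (-1) v
    + A.Y (omegaV A hgen a) 0 v ∈ P
  trans : ∀ (k : ℕ), ∀ v ∈ R, v ∈ A.wt k → A.Y A.omega 0 v + (k : ℂ) • v ∈ P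
  star : ∀ (k : ℕ), ∀ u ∈ P, u ∈ A.wt k → ∀ v ∈ P,
    ∑ i ∈ Finset.range (k + 1), (k.choose i : ℂ) • A.Y u ((i:ℤ) - 1) v ∈ P
  hS : ∀ a b m n, SV A hgen a b m n ∈ R
  s11 : ∀ a b, a ≠ b → SV A hgen a b 1 1 ∈ P
  om : ∀ a, omegaV A hgen a ∈ P
  J : ∀ a, JV A hgen a ∈ P
  one : A.one ∈ P

variable {R P : Submodule ℂ V}

lemma Good.star2 (H : IsHeisenberg A hgen) (G : Good A hgen R P) (a : Fin ℓ) {v : V} (hv : v ∈ P) :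
    A.Y (omegaV A hgen a) (-1) v + (2 : ℂ) • A.Y (omegaV A hgen a) 0 v
      + A.Y (omegaV A hgen a) 1 v ∈ P := by
  have := G.star 2 _ (G.om a) (omegaV_wt H a) v hv
  simpa [Finset.sum_range_succ] using this

lemma Good.S_ne (H : IsHeisenberg A hgen) (G : Good A hgen R P) {a b : Fin ℓ} (hab : a ≠ b)
    (m n : ℕ) : SV A hgen a b (m + 1) (n + 1) ∈ P := by
  have h1 : ∀ m : ℕ, SV A hgen a b (m + 1) 1 ∈ P := by
    intro m
    induction m with
    | zero => simpa using G.s11 a b hab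
    | succ m ih =>
      have h := G.comm a _ ih
      rw [omega_S_left H hab _ _ _ le_rfl, omega_S_left H hab _ _ _ (by norm_num)] at h
      have e : (m : ℤ) + 1 - 1 + 1 = m + 1 := by ring
      rw [e, sub_zero] at h
      have h := (Submodule.add_mem_iff_left _ (Submodule.smul_mem _ _ ih)).mp h
      have hne : (((m : ℤ) + 1 : ℤ) : ℂ) ≠ 0 := by exact_mod_cast (by omega : (m : ℤ) + 1 ≠ 0)
      have h := (Submodule.smul_mem_iff _ hne).mp h
      convert h using 2
      push_cast; ring
  induction n with
  | zero => simpa using h1 m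
  | succ m ih =>
      have h := G.comm b _ ih
      rw [omega_S_right H hab _ _ _ le_rfl, omega_S_right H hab _ _ _ (by norm_num)] at h
      have e : (m : ℤ) + 1 - 1 + 1 = m + 1 := by ring
      rw [e, sub_zero] at h
      have h := (Submodule.add_mem_iff_left _ (Submodule.smul_mem _ _ ih)).mp h
      have hne : (((m : ℤ) + 1 : ℤ) : ℂ) ≠ 0 := by exact_mod_cast (by omega : (m : ℤ) + 1 ≠ 0)
      have h := (Submodule.smul_mem_iff _ hne).mp h
      convert h using 2
      push_cast; ring

lemma Good.S_rel (H : IsHeisenberg A hgen) (G : Good A hgen R P) (a b : Fin ℓ) (m n : ℕ) :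
    (m : ℂ) • SV A hgen a b (m + 1) n + (n : ℂ) • SV A hgen a b m (n + 1)
      + ((m + n : ℕ) : ℂ) • SV A hgen a b m n ∈ P := by
  have h := G.trans (m + n) _ (G.hS a b m n) (by push_cast; exact SV_wt H a b m n)
  rw [om0_S] at h
  exact h

/-- all relations at a given weight reduce to `S(1,M)`. -/
lemma Good.S_red (H : IsHeisenberg A hgen) (G : Good A hgen R P) (a : Fin ℓ) (M : ℕ)
    (hlow : ∀ m n : ℕ, 1 ≤ m → 1 ≤ n → m + n ≤ M → SV A hgen a a m n ∈ P)
    (h1 : SV A hgen a a 1 M ∈ P) :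
    ∀ m n : ℕ, 1 ≤ m → 1 ≤ n → m + n ≤ M + 1 → SV A hgen a a m n ∈ P := by
  intro m n hm hn hmn
  rcases Nat.lt_or_ge (m + n) (M + 1) with h | h
  · exact hlow m n hm hn (by omega)
  · induction m, hm using Nat.le_induction generalizing n with
    | base =>
      have : n = M := by omega
      subst this; exact_mod_cast h1
    | succ m hm ih =>
      have h2 := ih (n + 1) (by omega) (by omega) (by omega)
      have h3 := hlow m n hm hn (by omega)
      have h4 := G.S_rel H a a m n
      have h5 := (Submodule.add_mem_iff_left _ (Submodule.smul_mem _ _ h3)).mp h4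
      push_cast at h2
      have h6 := (Submodule.add_mem_iff_left _ (Submodule.smul_mem _ _ h2)).mp h5
      have hne : (m : ℂ) ≠ 0 := by exact_mod_cast (by omega : m ≠ 0)
      have h7 := (Submodule.smul_mem_iff _ hne).mp h6
      exact_mod_cast h7

lemma omega_zero_S (H : IsHeisenberg A hgen) (a : Fin ℓ) (m n : ℤ) :
    A.Y (omegaV A hgen a) 0 (SV A hgen a a m n)
      = (n : ℂ) • SV A hgen a a m (n + 1) + (m : ℂ) • SV A hgen a a (m + 1) n := by
  rw [omega_S_same H, A.create_ge _ _ le_rfl]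
  simp

lemma omega_one_S (H : IsHeisenberg A hgen) (a : Fin ℓ) (m n : ℤ) :
    A.Y (omegaV A hgen a) 1 (SV A hgen a a m n)
      = ((m : ℂ) + n) • SV A hgen a a m n := by
  rw [omega_S_same H, A.create_ge _ _ (by norm_num)]
  simp
  module

lemma Good.S_step (H : IsHeisenberg A hgen) (G : Good A hgen R P) (a : Fin ℓ) (n : ℕ) (hn : 1 ≤ n)
    (hlow : ∀ p q : ℕ, 1 ≤ p → 1 ≤ q → p + q ≤ n + 3 → SV A hgen a a p q ∈ P) :
    SV A hgen a a 1 (n + 3 : ℕ) ∈ P := by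
  have L2 : ∀ p q : ℕ, 1 ≤ p → 1 ≤ q → p + q ≤ n + 2 →
      A.Y (omegaV A hgen a) (-1) (SV A hgen a a p q) ∈ P ∧
      A.Y (omegaV A hgen a) 0 (SV A hgen a a p q) ∈ P := by
    intro p q hp hq hpq
    have h0 := hlow p q hp hq (by omega)
    have h1 := G.star2 H a h0
    have h2 : A.Y (omegaV A hgen a) 0 (SV A hgen a a p q) ∈ P := by
      rw [omega_zero_S H]
      refine Submodule.add_mem _ (Submodule.smul_mem _ _ ?_) (Submodule.smul_mem _ _ ?_)
      · exact_mod_cast hlow p (q + 1) (by omega) (by omega) (by omega)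
      · exact_mod_cast hlow (p + 1) q (by omega) (by omega) (by omega)
    have h3 : A.Y (omegaV A hgen a) 1 (SV A hgen a a p q) ∈ P := by
      rw [omega_one_S H]
      exact Submodule.smul_mem _ _ h0
    refine ⟨?_, h2⟩
    have h4 := (Submodule.add_mem_iff_left _ h3).mp h1
    exact (Submodule.add_mem_iff_left _ (Submodule.smul_mem _ _ h2)).mp h4
  obtain ⟨k2, k1⟩ := L2 1 n le_rfl hn (by omega)
  have k3 : A.Y (omegaV A hgen a) (-2) (SV A hgen a a (1 : ℕ) n) ∈ P := by
    have h1 := G.circ a _ (G.hS a a (1 : ℕ) n)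
    have h4 := (Submodule.add_mem_iff_left _ k1).mp h1
    exact (Submodule.add_mem_iff_left _ (Submodule.smul_mem _ _ k2)).mp h4
  obtain ⟨k4, -⟩ := L2 2 n (by omega) hn (by omega)
  have k5 := Submodule.sub_mem _ k3 (Submodule.smul_mem _ 2 k4)
  have key : A.Y (omegaV A hgen a) (-2) (SV A hgen a a (1 : ℕ) n)
      - (2 : ℂ) • A.Y (omegaV A hgen a) (-1) (SV A hgen a a (2 : ℕ) n)
      = (n : ℂ) • SV A hgen a a 1 (n + 3) - (3 : ℂ) • SV A hgen a a 4 n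
        - (2 * n : ℂ) • SV A hgen a a 2 (n + 2) := by
    rw [omega_S_same H, omega_S_same H, omega_neg_two H, A.create]
    have e : A.Y (hgen a) (-(1:ℕ)) (A.Y (hgen a) (-n) (SV A hgen a a 2 1))
      = A.Y (hgen a) (-(2:ℕ)) (A.Y (hgen a) (-n) (SV A hgen a a 1 1)) := by
      unfold SV
      rw [h_comm0 H a a (-n) (-2) (by omega), h_comm0 H a a (-(1 : ℕ)) (-2) (by norm_num),
        h_comm0 H a a (-n) (-1) (by omega) (A.Y (hgen a) (-1) A.one)]
      rfl
    rw [e]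
    conv_lhs => rw [omegaV]
    have e1 : (n : ℤ) - -2 + 1 = n + 3 := by ring
    have e2 : ((1 : ℕ) : ℤ) - -2 + 1 = 4 := by norm_num
    have e3 : (n : ℤ) - -1 + 1 = n + 2 := by ring
    have e4 : ((2 : ℕ) : ℤ) - -1 + 1 = 4 := by norm_num
    rw [e1, e2, e3, e4]
    simp only [map_smul, Nat.cast_one, Nat.cast_ofNat, Int.cast_natCast, Int.cast_one,
      Int.cast_ofNat]
    module
  rw [key] at k5
  have r1 := G.S_rel H a a 1 (n + 2)
  have r2 := G.S_rel H a a 2 (n + 1)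
  have r3 := G.S_rel H a a 3 n
  have r1 := (Submodule.add_mem_iff_left _ (Submodule.smul_mem _ _
    (hlow 1 (n + 2) (by omega) (by omega) (by omega)))).mp r1
  have r2 := (Submodule.add_mem_iff_left _ (Submodule.smul_mem _ _
    (hlow 2 (n + 1) (by omega) (by omega) (by omega)))).mp r2
  have r3 := (Submodule.add_mem_iff_left _ (Submodule.smul_mem _ _
    (hlow 3 n (by omega) (by omega) (by omega)))).mp r3
  have f1 : ((n + 2 : ℕ) : ℤ) + 1 = n + 3 := by push_cast; ring
  have f2 : ((n + 1 : ℕ) : ℤ) + 1 = n + 2 := by push_cast; ring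
  have f3 : ((n + 2 : ℕ) : ℤ) = n + 2 := by push_cast; ring
  have f4 : ((n + 1 : ℕ) : ℤ) = n + 1 := by push_cast; ring
  have f5 : ((1 : ℕ) : ℤ) + 1 = 2 := rfl
  have f6 : ((2 : ℕ) : ℤ) + 1 = 3 := rfl
  have f7 : ((3 : ℕ) : ℤ) + 1 = 4 := rfl
  rw [f1, f3, f5] at r1
  rw [f2, f4, f6] at r2
  rw [f7] at r3
  have f8 : ((n + 3 : ℕ) : ℤ) = n + 3 := by push_cast; ring
  rw [f8]
  simp only [Nat.cast_one, Nat.cast_ofNat] at r1 r2 r3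
  generalize SV A hgen a a 1 (n + 3) = x at *
  generalize SV A hgen a a 2 (n + 2) = y at *
  generalize SV A hgen a a 3 (n + 1) = z at *
  generalize SV A hgen a a 4 n = t at *
  have tot : (((n * (n + 1) * (n + 2) + 4 * n * (n + 2) + 2 * n : ℕ) : ℂ)) • x ∈ P := by
    have := Submodule.add_mem _ (Submodule.add_mem _ (Submodule.smul_mem _ 2 k5)
      (Submodule.smul_mem _ 2 r3)) (Submodule.add_mem _ (Submodule.smul_mem _ (-n : ℂ) r2)
      (Submodule.smul_mem _ (n * (n + 1) + 4 * n : ℂ) r1))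
    convert this using 1
    push_cast
    module
  refine (Submodule.smul_mem_iff _ ?_).mp tot
  exact_mod_cast (by positivity : n * (n + 1) * (n + 2) + 4 * n * (n + 2) + 2 * n ≠ 0)

lemma Good.S_four (H : IsHeisenberg A hgen) (G : Good A hgen R P) (a : Fin ℓ)
    (hlow : ∀ p q : ℕ, 1 ≤ p → 1 ≤ q → p + q ≤ 3 → SV A hgen a a p q ∈ P) :
    SV A hgen a a 1 3 ∈ P := by
  have h0 := hlow 1 1 le_rfl le_rfl (by norm_num)
  have h1 := G.star2 H a h0
  rw [omega_zero_S H, omega_one_S H, omega_S_same H, A.create] at h1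
  have h2 := hlow 1 2 le_rfl (by norm_num) (by norm_num)
  have h3 := hlow 2 1 (by norm_num) (by norm_num) (by norm_num)
  have r := G.S_rel H a a 1 2
  have hJ := G.J a
  rw [JV] at hJ
  norm_num at h0 h1 h2 h3 r
  rw [SV_comm H a a 3 1 (by norm_num)] at h1 hJ
  conv at h1 => rw [omegaV]
  simp only [map_smul] at h1
  unfold SV at hJ h1 h2 h3 r h0 ⊢
  generalize A.Y (hgen a) (-1) (A.Y (hgen a) (-1) (A.Y (hgen a) (-1) (A.Y (hgen a) (-1) A.one))) = x at *
  generalize A.Y (hgen a) (-1) (A.Y (hgen a) (-3) A.one) = s13 at *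
  generalize A.Y (hgen a) (-2) (A.Y (hgen a) (-2) A.one) = s22 at *
  generalize A.Y (hgen a) (-1) (A.Y (hgen a) (-1) A.one) = s11 at *
  generalize A.Y (hgen a) (-1) (A.Y (hgen a) (-2) A.one) = s12 at *
  generalize A.Y (hgen a) (-2) (A.Y (hgen a) (-1) A.one) = s21 at *
  have := Submodule.sub_mem _ hJ (Submodule.smul_mem _ 2 h1)
  have := Submodule.sub_mem _ this (Submodule.smul_mem _ (3/2) r)
  have : (-9 : ℂ) • s13 ∈ P := by
    have := Submodule.add_mem _ this (Submodule.add_mem _ (Submodule.smul_mem _ (4 + 9/2) h2)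
      (Submodule.add_mem _ (Submodule.smul_mem _ 4 h3) (Submodule.smul_mem _ 4 h0)))
    convert this using 1
    module
  exact (Submodule.smul_mem_iff _ (by norm_num)).mp this

lemma Good.S_same (H : IsHeisenberg A hgen) (G : Good A hgen R P) (a : Fin ℓ) (N : ℕ) :
    ∀ p q : ℕ, 1 ≤ p → 1 ≤ q → p + q ≤ N → SV A hgen a a p q ∈ P := by
  have h11 : SV A hgen a a 1 1 ∈ P := (Submodule.smul_mem_iff _ (by norm_num)).mp (G.om a)
  induction N with
  | zero => intro p q; omega
  | succ N ih =>
    rcases (by omega : N = 0 ∨ N = 1 ∨ N = 2 ∨ N = 3 ∨ 4 ≤ N) with rfl | rfl | rfl | rfl | h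
    · intro p q; omega
    · exact G.S_red H a 1 ih (by exact_mod_cast h11)
    · refine G.S_red H a 2 ih ?_
      have r := G.S_rel H a a 1 1
      have r := (Submodule.add_mem_iff_left _ (Submodule.smul_mem _ _ (by exact_mod_cast h11))).mp r
      norm_num at r
      rw [SV_comm H a a 2 1 (by norm_num), ← two_smul ℂ] at r
      exact_mod_cast (Submodule.smul_mem_iff _ (by norm_num)).mp r
    · exact G.S_red H a 3 ih (by exact_mod_cast G.S_four H a ih)
    · obtain ⟨n, rfl⟩ : ∃ n, N = n + 3 := ⟨N - 3, by omega⟩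
      exact G.S_red H a _ ih (G.S_step H a n (by omega) ih)

lemma Good.S_all (H : IsHeisenberg A hgen) (G : Good A hgen R P) (a b : Fin ℓ) (m n : ℕ) :
    SV A hgen a b (m + 1) (n + 1) ∈ P := by
  by_cases hab : a = b
  · subst hab
    exact_mod_cast G.S_same H a (m + 1 + (n + 1)) (m + 1) (n + 1) (by omega) (by omega) le_rfl
  · exact G.S_ne H hab m n

end heis
end HZ

open scoped BigOperators DirectSum TensorProduct
namespace HZ
open LaurentPolynomial Filter

variable {V : Type} [AddCommGroup V] [Module ℂ V]

lemma finsum_sub_mem {F : Submodule ℂ V} {f : ℕ → V} (h : ∀ᶠ i in atTop, f i = 0) (x : V)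
    (h0 : f 0 - x ∈ F) (h1 : ∀ i, f (i + 1) ∈ F) : (∑ᶠ i, f i) - x ∈ F := by
  obtain ⟨N, hN, h2⟩ := ((finsum_eventually h).and (eventually_ge_atTop 1)).exists
  obtain ⟨M, rfl⟩ : ∃ M, N = M + 1 := ⟨N - 1, by omega⟩
  rw [hN, Finset.sum_range_succ', add_sub_assoc]
  exact Submodule.add_mem _ (Submodule.sum_mem _ fun i _ => h1 i) h0

section heis
variable {ℓ : ℕ} {A : VOA V} {hgen : Fin ℓ → V}

/-- The monomial attached to a word. -/
def word (A : VOA V) (hgen : Fin ℓ → V) (L : List (Fin ℓ × ℕ+)) : V :=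
  wordAct (fun a k w => A.Y (hgen a) k w) L A.one

lemma word_cons (a : Fin ℓ) (n : ℕ+) (L : List (Fin ℓ × ℕ+)) :
    word A hgen ((a, n) :: L) = A.Y (hgen a) (-((n : ℕ) : ℤ)) (word A hgen L) := rfl

/-- Filtration by length. -/
def Fl (A : VOA V) (hgen : Fin ℓ → V) (r : ℕ) : Submodule ℂ V :=
  Submodule.span ℂ {v | ∃ L : List (Fin ℓ × ℕ+), L.length < r ∧ v = word A hgen L}

lemma word_mem {L : List (Fin ℓ × ℕ+)} {r : ℕ} (h : L.length < r) : word A hgen L ∈ Fl A hgen r :=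
  Submodule.subset_span ⟨L, h, rfl⟩

lemma Fl_mono {r s : ℕ} (h : r ≤ s) : Fl A hgen r ≤ Fl A hgen s :=
  Submodule.span_mono fun _ ⟨L, hL, e⟩ => ⟨L, by omega, e⟩

lemma Fl_neg (b : Fin ℓ) (n : ℤ) (hn : n < 0) {r : ℕ} {x : V} (hx : x ∈ Fl A hgen r) :
    A.Y (hgen b) n x ∈ Fl A hgen (r + 1) := by
  induction hx using Submodule.span_induction with
  | zero => rw [map_zero]; exact Submodule.zero_mem _
  | add x y _ _ h1 h2 => rw [map_add]; exact Submodule.add_mem _ h1 h2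
  | smul c x _ h => rw [map_smul]; exact Submodule.smul_mem _ _ h
  | mem x hx =>
    obtain ⟨L, hL, rfl⟩ := hx
    refine Submodule.subset_span ⟨(b, ⟨n.natAbs, by omega⟩) :: L, by simpa using hL, ?_⟩
    have e : n = -((n.natAbs : ℕ) : ℤ) := by omega
    conv_lhs => rw [e]
    rfl

lemma Fl_ann_word (H : IsHeisenberg A hgen) (b : Fin ℓ) (j : ℤ) (hj : 0 ≤ j)
    (L : List (Fin ℓ × ℕ+)) : A.Y (hgen b) j (word A hgen L) ∈ Fl A hgen L.length := by
  induction L with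
  | nil =>
    have : A.Y (hgen b) j (word A hgen []) = 0 := A.create_ge _ _ hj
    rw [this]; exact Submodule.zero_mem _
  | cons x L ih =>
    obtain ⟨a, n⟩ := x
    rw [word_cons, h_comm H]
    refine Submodule.add_mem _ ?_ (Submodule.smul_mem _ _ (word_mem (by simp)))
    exact Fl_neg a _ (by have := n.pos; omega) ih

lemma Fl_ann (H : IsHeisenberg A hgen) (b : Fin ℓ) (j : ℤ) (hj : 0 ≤ j) {r : ℕ} {x : V}
    (hx : x ∈ Fl A hgen (r + 1)) : A.Y (hgen b) j x ∈ Fl A hgen r := by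
  induction hx using Submodule.span_induction with
  | zero => rw [map_zero]; exact Submodule.zero_mem _
  | add x y _ _ h1 h2 => rw [map_add]; exact Submodule.add_mem _ h1 h2
  | smul c x _ h => rw [map_smul]; exact Submodule.smul_mem _ _ h
  | mem x hx =>
    obtain ⟨L, hL, rfl⟩ := hx
    exact Fl_mono (by omega) (Fl_ann_word H b j hj L)

lemma Fl_any (H : IsHeisenberg A hgen) (b : Fin ℓ) (j : ℤ) {r : ℕ} {x : V}
    (hx : x ∈ Fl A hgen r) : A.Y (hgen b) j x ∈ Fl A hgen (r + 1) := by
  rcases lt_or_ge j 0 with h | h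
  · exact Fl_neg b j h hx
  · exact Fl_mono (by omega) (Fl_ann H b j h (r := r) (Fl_mono (by omega) hx))

lemma mode_one (b : Fin ℓ) (n : ℕ) (q : ℤ) :
    A.Y (A.Y (hgen b) (-(n + 1)) A.one) q = ((-1) ^ n * zchoose q n) • A.Y (hgen b) (q - n) := by
  induction n generalizing q with
  | zero => simp [A.create, zchoose_zero]
  | succ n ih =>
    have h := A.translation (A.Y (hgen b) (-(n + 1)) A.one) q
    rw [om0, om0_one, ih] at h
    have hz := zchoose_succ q n
    have hne : (n : ℂ) + 1 ≠ 0 := by exact_mod_cast (by omega : n + 1 ≠ 0)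
    have e1 : -((n : ℤ) + 1) - 1 = -(((n + 1 : ℕ) : ℤ) + 1) := by push_cast; ring
    have e2 : q - 1 - (n : ℤ) = q - ((n + 1 : ℕ) : ℤ) := by push_cast; ring
    rw [e1, e2] at h
    simp only [map_zero, zero_sub, map_neg, map_smul, Pi.neg_apply, Pi.smul_apply] at h
    apply smul_right_injective _ hne
    simp only
    calc _ = -(((-((n:ℤ) + 1) : ℤ) : ℂ) • A.Y (A.Y (hgen b) (-(((n + 1 : ℕ) : ℤ) + 1)) A.one) q) := by
            push_cast; module
      _ = _ := by
        rw [h, smul_smul, smul_smul]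
        congr 1
        rw [pow_succ]
        linear_combination (-1)^n * hz

lemma mode_one_lead (b : Fin ℓ) (n : ℕ) :
    A.Y (A.Y (hgen b) (-(n + 1)) A.one) (-1) = A.Y (hgen b) (-(n + 1)) := by
  rw [mode_one, zchoose_neg_one, ← mul_pow]
  have : (-1 : ℤ) - n = -(n + 1) := by ring
  rw [this]; simp

lemma mode_one_ann (H : IsHeisenberg A hgen) (b : Fin ℓ) (n : ℕ) (q : ℤ) (hq : 0 ≤ q) {r : ℕ} {x : V}
    (hx : x ∈ Fl A hgen (r + 1)) :
    A.Y (A.Y (hgen b) (-(n + 1)) A.one) q x ∈ Fl A hgen r := by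
  rw [mode_one, LinearMap.smul_apply]
  obtain ⟨k, rfl⟩ := Int.eq_ofNat_of_zero_le hq
  have hz : zchoose (Int.ofNat k) n = _ := zchoose_nat k n
  rcases Nat.lt_or_ge k n with h | h
  · have : zchoose (k : ℤ) n = 0 := by rw [zchoose_nat, Nat.choose_eq_zero_of_lt h]; simp
    rw [this]; simp
  · exact Submodule.smul_mem _ _ (Fl_ann H b _ (by omega) hx)

lemma mode_one_any (H : IsHeisenberg A hgen) (b : Fin ℓ) (n : ℕ) (q : ℤ) {r : ℕ} {x : V}
    (hx : x ∈ Fl A hgen r) :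
    A.Y (A.Y (hgen b) (-(n + 1)) A.one) q x ∈ Fl A hgen (r + 1) := by
  rw [mode_one, LinearMap.smul_apply]
  exact Submodule.smul_mem _ _ (Fl_any H b _ hx)

lemma mode_S (H : IsHeisenberg A hgen) (a b : Fin ℓ) (m n : ℕ) (q : ℤ) (hq : -1 ≤ q) {r : ℕ} {w : V}
    (hw : w ∈ Fl A hgen (r + 1)) :
    A.Y (SV A hgen a b (m + 1) (n + 1)) q w
      - (if q = -1 then A.Y (hgen a) (-(m + 1)) (A.Y (hgen b) (-(n + 1)) w) else 0)
      ∈ Fl A hgen (r + 1) := by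
  have h := A.borcherds (hgen a) (A.Y (hgen b) (-(n + 1)) A.one) w (-(m + 1)) 0 q
  rw [finsum_eq_single _ 0] at h
  · simp only [zchoose_zero, Nat.cast_zero, add_zero, sub_zero, zero_add, one_smul] at h
    unfold SV
    rw [h]
    apply finsum_sub_mem
    · filter_upwards [trunc_nat A (A.Y (hgen b) (-(n + 1)) A.one) w q,
        trunc_nat A (hgen a) w 0] with i h1 h2
      rw [zero_add] at h2
      rw [h1, h2]; simp
    · rw [zchoose_zero]
      simp only [pow_zero, mul_one, one_smul, Nat.cast_zero, sub_zero, add_zero]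
      rw [sub_right_comm]
      refine Submodule.sub_mem _ ?_ (Submodule.smul_mem _ _ (mode_one_any H b n _
        (Fl_ann H a 0 le_rfl hw)))
      split_ifs with hq1
      · subst hq1
        rw [mode_one_lead, sub_self]; exact Submodule.zero_mem _
      · rw [sub_zero]
        exact Fl_any H a _ (mode_one_ann H b n q (by omega) hw)
    · intro i
      refine Submodule.smul_mem _ _ (Submodule.sub_mem _ ?_ (Submodule.smul_mem _ _ ?_))
      · exact Fl_any H a _ (mode_one_ann H b n _ (by push_cast; omega) hw)
      · exact mode_one_any H b n _ (Fl_ann H a _ (by omega) hw)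
  · intro i hi
    obtain ⟨j, rfl⟩ := Nat.exists_eq_succ_of_ne_zero hi
    simp [zchoose_zero_succ]

lemma star_S (H : IsHeisenberg A hgen) (a b : Fin ℓ) (m n : ℕ) (k : ℕ) {r : ℕ} {w : V}
    (hw : w ∈ Fl A hgen (r + 1)) :
    ∑ i ∈ Finset.range (k + 1), (k.choose i : ℂ) •
        A.Y (SV A hgen a b (m + 1) (n + 1)) ((i:ℤ) - 1) w
      - A.Y (hgen a) (-(m + 1)) (A.Y (hgen b) (-(n + 1)) w) ∈ Fl A hgen (r + 1) := by
  rw [Finset.sum_range_succ', add_sub_assoc]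
  refine Submodule.add_mem _ (Submodule.sum_mem _ fun i _ => Submodule.smul_mem _ _ ?_) ?_
  · have := mode_S H a b m n (((i + 1 : ℕ) : ℤ) - 1) (by omega) hw
    rwa [if_neg (by omega), sub_zero] at this
  · have := mode_S H a b m n (-1) le_rfl hw
    simpa using this

lemma theta_word {θ : V ≃ₗ[ℂ] V} (hθ : IsThetaAut A hgen θ) (L : List (Fin ℓ × ℕ+)) :
    θ (word A hgen L) = (-1 : ℂ) ^ L.length • word A hgen L := by
  induction L with
  | nil => simpa [word, wordAct] using hθ.map_one
  | cons x L ih =>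
    obtain ⟨a, n⟩ := x
    rw [word_cons, hθ.map_Y, hθ.map_gen, ih, List.length_cons, pow_succ]
    simp only [map_neg, map_smul, Pi.neg_apply, LinearMap.neg_apply]
    module

lemma fixed_mem {θ : V ≃ₗ[ℂ] V} (hθ : IsThetaAut A hgen θ) {r : ℕ} {P : Submodule ℂ V}
    (hP : ∀ L : List (Fin ℓ × ℕ+), Even L.length → L.length < r → word A hgen L ∈ P)
    {x : V} (hx : x ∈ Fl A hgen r) (hxθ : θ x = x) : x ∈ P := by
  have key : x + θ x ∈ P := by
    clear hxθ
    induction hx using Submodule.span_induction with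
    | zero => simp
    | add x y _ _ h1 h2 =>
      rw [map_add]; convert Submodule.add_mem _ h1 h2 using 1; abel
    | smul c x _ h => rw [map_smul, ← smul_add]; exact Submodule.smul_mem _ _ h
    | mem x hx =>
      obtain ⟨L, hL, rfl⟩ := hx
      rw [theta_word hθ]
      rcases Nat.even_or_odd L.length with h | h
      · rw [h.neg_one_pow, one_smul]
        exact Submodule.add_mem _ (hP L h hL) (hP L h hL)
      · rw [h.neg_one_pow]; simp
  rw [hxθ, ← two_smul ℂ] at key
  exact (Submodule.smul_mem_iff _ (by norm_num)).mp key

variable {R P : Submodule ℂ V}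

lemma Good.word_mem (H : IsHeisenberg A hgen) (G : Good A hgen R P) {θ : V ≃ₗ[ℂ] V}
    (hθ : IsThetaAut A hgen θ) (hPθ : ∀ x ∈ P, θ x = x) (r : ℕ) (L : List (Fin ℓ × ℕ+)) :
    Even L.length → L.length < r → word A hgen L ∈ P := by
  induction r generalizing L with
  | zero => intro _ h; omega
  | succ r ih =>
    intro hev hr
    match L, hev, hr with
    | [], _, _ => exact G.one
    | [x], hev, _ => simp at hev
    | (a, m) :: (b, n) :: L, hev, hr =>
      simp only [List.length_cons] at hr
      have hev' : Even L.length := by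
        simp only [List.length_cons] at hev
        exact (Nat.even_add.mp (by simpa [add_assoc] using hev : Even (L.length + 2))).mpr even_two
      have hw := ih L hev' (by omega)
      obtain ⟨m', hm⟩ : ∃ m' : ℕ, ((m : ℕ) : ℤ) = m' + 1 := ⟨m - 1, by have := m.pos; omega⟩
      obtain ⟨n', hn⟩ : ∃ n' : ℕ, ((n : ℕ) : ℤ) = n' + 1 := ⟨n - 1, by have := n.pos; omega⟩
      have hS := G.S_all H a b m' n'
      have hst := G.star (m' + 1 + (n' + 1)) _ hS
        (by have := SV_wt H a b (m' + 1) (n' + 1); exact_mod_cast this) _ hw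
      have hd := star_S H a b m' n' (m' + 1 + (n' + 1)) (r := L.length) (w := word A hgen L)
        (HZ.word_mem (by omega))
      have e : word A hgen ((a, m) :: (b, n) :: L)
        = A.Y (hgen a) (-(m' + 1)) (A.Y (hgen b) (-(n' + 1)) (word A hgen L)) := by
        rw [word_cons, word_cons, hm, hn]
      rw [← e] at hd
      have hd2 := fixed_mem hθ (P := P) (fun L' h1 h2 => ih L' h1 (by omega)) hd (by
        rw [map_sub, hPθ _ hst, theta_word hθ, hev.neg_one_pow, one_smul])
      have := Submodule.sub_mem _ hst hd2
      simpa using this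

lemma Good.all (H : IsHeisenberg A hgen) (G : Good A hgen R P) {θ : V ≃ₗ[ℂ] V}
    (hθ : IsThetaAut A hgen θ) (hPθ : ∀ x ∈ P, θ x = x) (x : V) (hx : θ x = x) : x ∈ P := by
  have : ∃ r, x ∈ Fl A hgen r := by
    clear hx
    have hx : x ∈ (⊤ : Submodule ℂ V) := trivial
    rw [← H.span_words] at hx
    induction hx using Submodule.span_induction with
    | zero => exact ⟨0, Submodule.zero_mem _⟩
    | add x y _ _ h1 h2 =>
      obtain ⟨r, h1⟩ := h1
      obtain ⟨s, h2⟩ := h2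
      exact ⟨r + s, Submodule.add_mem _ (Fl_mono (by omega) h1) (Fl_mono (by omega) h2)⟩
    | smul c x _ h =>
      obtain ⟨r, h1⟩ := h
      exact ⟨r, Submodule.smul_mem _ _ h1⟩
    | mem x hx =>
      obtain ⟨L, rfl⟩ := hx
      exact ⟨L.length + 1, HZ.word_mem (by omega)⟩
  obtain ⟨r, hr⟩ := this
  exact fixed_mem hθ (fun L h1 h2 => G.word_mem H hθ hPθ r L h1 h2) hr hx

lemma nonneg_heis (H : IsHeisenberg A hgen) : NonnegWt A := by
  intro k hk
  have hword : ∀ L : List (Fin ℓ × ℕ+), ∃ n : ℕ, word A hgen L ∈ A.wt n := by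
    intro L
    induction L with
    | nil => exact ⟨0, A.one_wt⟩
    | cons x L ih =>
      obtain ⟨a, m⟩ := x
      obtain ⟨n, hn⟩ := ih
      refine ⟨n + m, ?_⟩
      have := A.mode_wt 1 _ (H.wt_one a) n (-((m : ℕ) : ℤ)) _ hn
      rw [word_cons]
      convert this using 2
      push_cast; ring
  have hall : ∀ x : V, A.hcomp k x = 0 := by
    intro x
    have hx : x ∈ (⊤ : Submodule ℂ V) := trivial
    rw [← H.span_words] at hx
    induction hx using Submodule.span_induction with
    | zero => simp [VOA.hcomp]
    | add x y _ _ h1 h2 => rw [hcomp_add, h1, h2, add_zero]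
    | smul c x _ h => rw [hcomp_smul, h, smul_zero]
    | mem x hx =>
      obtain ⟨L, rfl⟩ := hx
      obtain ⟨n, hn⟩ := hword L
      have := hcomp_of A hn k
      rw [if_neg (by omega)] at this
      exact this
  rw [eq_bot_iff]
  intro x hx
  have := hcomp_of A hx k
  rw [if_pos rfl, hall] at this
  exact (Submodule.mem_bot ℂ).mpr this.symm

end heis
end HZ

open scoped BigOperators DirectSum TensorProduct
namespace HZ
open LaurentPolynomial Filter

variable {W : Type} [AddCommGroup W] [Module ℂ W]

/-- The generated subalgebra together with `O(V)`. -/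
def Gp (B : VOA W) (gens : Set W) : Submodule ℂ W := genMonomials B gens ⊔ B.Osub

/-- The left multiplier of `Gp`. -/
def Tm (B : VOA W) (hB : NonnegWt B) (gens : Set W) : Submodule ℂ W where
  carrier := {u | ∀ x ∈ Gp B gens, B.star u x ∈ Gp B gens}
  zero_mem' := fun x _ => by rw [star_zero_left B hB]; exact Submodule.zero_mem _
  add_mem' := fun {u v} hu hv x hx => by
    rw [star_add_left B hB]; exact Submodule.add_mem _ (hu x hx) (hv x hx)
  smul_mem' := fun c u hu x hx => by
    rw [star_smul_left B hB]; exact Submodule.smul_mem _ _ (hu x hx)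

variable {B : VOA W} {hB : NonnegWt B} {gens : Set W}

lemma O_le_Gp : B.Osub ≤ Gp B gens := le_sup_right

lemma mem_Tm {u : W} : u ∈ Tm B hB gens ↔ ∀ x ∈ Gp B gens, B.star u x ∈ Gp B gens := Iff.rfl

lemma gens_Tm {g : W} (hg : g ∈ gens) : g ∈ Tm B hB gens := by
  intro x hx
  obtain ⟨y, hy, z, hz, rfl⟩ := Submodule.mem_sup.mp hx
  rw [star_add_right B hB]
  refine Submodule.add_mem _ (Submodule.mem_sup_left ?_) (O_le_Gp (left_ideal B hB g hz))
  clear hx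
  unfold genMonomials at hy ⊢
  induction hy using Submodule.span_induction with
  | zero => rw [← starL_apply B hB, map_zero]; exact Submodule.zero_mem _
  | add x y _ _ h1 h2 =>
    rw [star_add_right B hB]
    exact Submodule.add_mem _ h1 h2
  | smul c x _ h =>
    rw [star_smul_right B hB]
    exact Submodule.smul_mem _ _ h
  | mem x hx =>
    obtain ⟨L, hL, rfl⟩ := hx
    exact Submodule.subset_span ⟨g :: L, by simpa using ⟨hg, hL⟩, rfl⟩

lemma O_Tm {g : W} (hg : g ∈ B.Osub) : g ∈ Tm B hB gens :=
  fun x _ => O_le_Gp (right_ideal B hB x hg)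

lemma one_Tm : B.one ∈ Tm B hB gens := by
  intro x hx
  rw [star_hom_sum B (k := 0) B.one_wt x (N := 1) le_rfl]
  simpa [B.vacuum_act] using hx

lemma Tm_le {u : W} (hu : u ∈ Tm B hB gens) : u ∈ Gp B gens := by
  have := hu B.one (Submodule.mem_sup_left (Submodule.subset_span ⟨[], by simp, rfl⟩))
  rwa [star_one B hB] at this

lemma star_Tm {u v : W} (hu : u ∈ Tm B hB gens) (hv : v ∈ Tm B hB gens) :
    B.star u v ∈ Tm B hB gens := by
  intro x hx
  have := O_le_Gp (gens := gens) (assoc B hB u v x)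
  simpa using Submodule.add_mem _ this (hu _ (hv x hx))

lemma comm_Tm {u v : W} (hu : u ∈ Tm B hB gens) (hu2 : u ∈ B.wt 2) (hv : v ∈ Tm B hB gens) :
    B.Y u 0 v + B.Y u 1 v ∈ Tm B hB gens := by
  intro x hx
  have h := O_le_Gp (gens := gens) (comm_two B hB hu2 v x)
  have h2 := Submodule.sub_mem _ (hu _ (hv x hx)) (hv _ (hu x hx))
  simpa using Submodule.sub_mem _ h2 h

lemma trans_Tm {k : ℕ} {u : W} (hu : u ∈ B.wt k) :
    B.Y B.omega 0 u + (k : ℂ) • u ∈ Tm B hB gens := by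
  intro x hx
  rw [circ_star B hB hu]
  exact O_le_Gp (Submodule.subset_span ⟨k, u, x, hu, rfl⟩)

lemma circ_Tm {u v : W} (hu : u ∈ B.wt 2) :
    B.Y u (-2) v + (2 : ℂ) • B.Y u (-1) v + B.Y u 0 v ∈ Tm B hB gens := by
  apply O_Tm
  have h : B.circAux (2 : ℕ) u v ∈ B.Osub := Submodule.subset_span ⟨2, u, v, hu, rfl⟩
  rw [circAux_eq] at h
  have e : (X1 ^ 2 * T (-2) : LP) = T (-2) + (2 : ℂ) • T (-1) + T 0 := by
    have e1 : (T (-1) : LP) = T 1 * T (-2) := by rw [← T_add]; norm_num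
    have e2 : (T 0 : LP) = T 1 * T 1 * T (-2) := by rw [← T_add, ← T_add]; norm_num
    rw [e1, e2, LaurentPolynomial.smul_eq_C_mul, map_ofNat]
    ring
  rw [e] at h
  simpa only [map_add, map_smul, res_T, LinearMap.add_apply, LinearMap.smul_apply] using h

lemma main_aux (ℓ : ℕ) {V : Type} [AddCommGroup V] [Module ℂ V]
    (S : HeisenbergPlusSetting ℓ V W)
    (s : Fin ℓ → Fin ℓ → ℤ → ℤ → W)
    (hs : ∀ a b m n, S.ι (s a b m n) = SV S.A S.hgen a b m n)
    (ow : Fin ℓ → W) (how : ∀ a, S.ι (ow a) = omegaV S.A S.hgen a)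
    (Jw : Fin ℓ → W) (hJw : ∀ a, S.ι (Jw a) = JV S.A S.hgen a) (gens : Set W)
    (g1 : ∀ a, ow a ∈ gens) (g2 : ∀ a, Jw a ∈ gens) (g3 : ∀ a b, a ≠ b → s a b 1 1 ∈ gens)
    (x : W) : ∃ y ∈ genMonomials S.B gens, x - y ∈ S.B.Osub := by
  have hB : NonnegWt S.B := by
    intro k hk
    rw [eq_bot_iff]
    intro w hw
    have h := (S.fixedSub.map_wt k w).mp hw
    rw [nonneg_heis S.heis k hk, Submodule.mem_bot] at h
    rw [Submodule.mem_bot]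
    exact S.fixedSub.inj (by rw [h, map_zero])
  have hF := S.fixedSub
  have how2 : ∀ a, ow a ∈ S.B.wt 2 := fun a =>
    (hF.map_wt 2 _).mpr (by rw [how]; exact omegaV_wt S.heis a)
  have hθ : ∀ w, S.θ (S.ι w) = S.ι w := by
    intro w
    have : S.ι w ∈ LinearMap.range S.ι := ⟨w, rfl⟩
    rw [hF.range_eq, Module.End.mem_eigenspace_iff] at this
    simpa using this
  have G : Good S.A S.hgen (LinearMap.range S.ι) ((Tm S.B hB gens).map S.ι) :=
    { comm := by
        rintro a _ ⟨t, ht, rfl⟩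
        refine ⟨_, comm_Tm (gens_Tm (g1 a)) (how2 a) ht, ?_⟩
        rw [map_add, hF.map_Y, hF.map_Y, how]
      circ := by
        rintro a _ ⟨t, rfl⟩
        refine ⟨_, circ_Tm (v := t) (how2 a), ?_⟩
        rw [map_add, map_add, map_smul, hF.map_Y, hF.map_Y, hF.map_Y, how]
      trans := by
        rintro k _ ⟨t, rfl⟩ hk
        refine ⟨_, trans_Tm ((hF.map_wt k t).mpr hk), ?_⟩
        rw [map_add, map_smul, hF.map_Y, hF.map_omega]
      star := by
        rintro k _ ⟨u, hu, rfl⟩ hk _ ⟨v, hv, rfl⟩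
        refine ⟨_, star_Tm hu hv, ?_⟩
        rw [star_hom_sum S.B ((hF.map_wt k u).mpr hk) v le_rfl, map_sum]
        refine Finset.sum_congr rfl fun i _ => ?_
        rw [map_smul, hF.map_Y]
      hS := fun a b m n => ⟨_, hs a b m n⟩
      s11 := fun a b hab => ⟨_, gens_Tm (g3 a b hab), hs a b 1 1⟩
      om := fun a => ⟨_, gens_Tm (g1 a), how a⟩
      J := fun a => ⟨_, gens_Tm (g2 a), hJw a⟩
      one := ⟨_, one_Tm, hF.map_one⟩ }
  obtain ⟨t, ht, hxt⟩ := G.all S.heis S.thetaAut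
    (by rintro _ ⟨t, -, rfl⟩; exact hθ t) (S.ι x) (hθ x)
  rw [← hF.inj hxt]
  obtain ⟨y, hy, z, hz, e⟩ := Submodule.mem_sup.mp (Tm_le ht)
  exact ⟨y, hy, by rw [← e]; simpa using hz⟩

end HZ


/-- Remark 4.9. Zhu's algebra `A(𝓗⁺)` is generated as an
associative algebra by the finitely many elements `[ω_a]`, `[J_a]`
(`a = 1,…,ℓ`) and `[h_a(-1)h_b(-1)𝟏]` (`a ≠ b`): every element of `A(𝓗⁺)` is a
linear combination of Zhu-monomials in these generators. -/
theorem statement12 (ℓ : ℕ) {V W : Type} [AddCommGroup V] [Module ℂ V]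
    [AddCommGroup W] [Module ℂ W] (S : HeisenbergPlusSetting ℓ V W)
    (s : Fin ℓ → Fin ℓ → ℤ → ℤ → W)
    (hs : ∀ a b m n, S.ι (s a b m n) = SV S.A S.hgen a b m n)
    (ow : Fin ℓ → W) (how : ∀ a, S.ι (ow a) = omegaV S.A S.hgen a)
    (Jw : Fin ℓ → W) (hJw : ∀ a, S.ι (Jw a) = JV S.A S.hgen a) :
    ∀ x : W, ∃ y ∈ genMonomials S.B
      (Set.range ow ∪ Set.range Jw
        ∪ {z : W | ∃ a b : Fin ℓ, a ≠ b ∧ z = s a b 1 1}),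
      x - y ∈ S.B.Osub := by
  exact HZ.main_aux ℓ S s hs ow how Jw hJw _ (fun a => Or.inl (Or.inl ⟨a, rfl⟩))
    (fun a => Or.inl (Or.inr ⟨a, rfl⟩)) (fun a b hab => Or.inr ⟨a, b, hab, rfl⟩)
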